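/- Let H be a separable infinite-dimensional complex Hilbert space and T a bounded operator on H. Then the closure of the unitary orbit U(T) in the *-strong operator topology equals the set of all bounded operators B on H such that B is unitarily equivalent to a reducing part of some operator in the norm closure of U(T). -/

import Mathlib

open Filter Topology ContinuousLinearMap

/-- Conjugation of an operator by a unitary (linear isometric equivalence): `W T W*`. -/
noncomputable def conjOp {H₁ H₂ : Type*} [NormedAddCommGroup H₁] [InnerProductSpace ℂ H₁]
    [NormedAddCommGroup H₂] [InnerProductSpace ℂ H₂]
    (W : H₁ ≃ₗᵢ[ℂ] H₂) (T : H₁ →L[ℂ] H₁) : H₂ →L[ℂ] H₂ :=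
  ((W.toContinuousLinearEquiv : H₁ →L[ℂ] H₂).comp T).comp
    ((W.symm.toContinuousLinearEquiv : H₂ →L[ℂ] H₁))

/-- The restriction of an operator to an invariant subspace. -/
noncomputable def opRestrict {H : Type*} [NormedAddCommGroup H] [InnerProductSpace ℂ H]
    (T : H →L[ℂ] H) (M : Submodule ℂ H) (hM : ∀ x ∈ M, T x ∈ M) : M →L[ℂ] M :=
  { toLinearMap := (T : H →ₗ[ℂ] H).restrict hM
    cont := Continuous.subtype_mk (T.continuous.comp continuous_subtype_val) _ }

/-- Two operators (possibly on different Hilbert spaces) are *compalent* if one is a compact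
perturbation of a unitary conjugate of the other: `T₂ = W T₁ W* + K` with `K` compact. -/
def Compalent {H₁ H₂ : Type*} [NormedAddCommGroup H₁] [InnerProductSpace ℂ H₁]
    [NormedAddCommGroup H₂] [InnerProductSpace ℂ H₂]
    (T₁ : H₁ →L[ℂ] H₁) (T₂ : H₂ →L[ℂ] H₂) : Prop :=
  ∃ W : H₁ ≃ₗᵢ[ℂ] H₂, IsCompactOperator (T₂ - conjOp W T₁)

/-- `S` is compalent to a reducing part of `T`, that is, to the restriction of `T` to a closed
subspace invariant under both `T` and `T*`. -/
def CompalentToReducingPart {H : Type*} [NormedAddCommGroup H] [InnerProductSpace ℂ H]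
    [CompleteSpace H] (S T : H →L[ℂ] H) : Prop :=
  ∃ (M : Submodule ℂ H) (_ : IsClosed (M : Set H))
    (hT : ∀ x ∈ M, T x ∈ M) (_ : ∀ x ∈ M, ContinuousLinearMap.adjoint T x ∈ M),
    Compalent S (opRestrict T M hT)

/-- The unitary orbit of `T`: all operators `W T W*` for unitaries `W`. -/
def unitaryOrbit {H : Type*} [NormedAddCommGroup H] [InnerProductSpace ℂ H]
    (T : H →L[ℂ] H) : Set (H →L[ℂ] H) :=
  {A | ∃ W : H ≃ₗᵢ[ℂ] H, A = conjOp W T}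

/-- The strong operator topology on `B(H)`: induced by the inclusion into `H → H` with the
topology of pointwise convergence. -/
noncomputable def sot (H : Type*) [NormedAddCommGroup H] [InnerProductSpace ℂ H] :
    TopologicalSpace (H →L[ℂ] H) :=
  TopologicalSpace.induced (fun T => (T : H → H)) Pi.topologicalSpace

/-- Closure in the strong operator topology. -/
noncomputable def sotClosure {H : Type*} [NormedAddCommGroup H] [InnerProductSpace ℂ H]
    (S : Set (H →L[ℂ] H)) : Set (H →L[ℂ] H) :=
  @closure _ (sot H) S

/-- `B` (an operator on `G`) is, up to unitary equivalence, the restriction of `A` to a closed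
invariant subspace. -/
def IsRestrictionOf {G H : Type*} [NormedAddCommGroup G] [InnerProductSpace ℂ G]
    [NormedAddCommGroup H] [InnerProductSpace ℂ H]
    (B : G →L[ℂ] G) (A : H →L[ℂ] H) : Prop :=
  ∃ (M : Submodule ℂ H) (_ : IsClosed (M : Set H)) (hinv : ∀ x ∈ M, A x ∈ M),
    ∃ W : G ≃ₗᵢ[ℂ] M, opRestrict A M hinv = conjOp W B

/-- The *-strong operator topology on `B(H)`: induced by `T ↦ (T, T*)` with the topology of
pointwise convergence in each coordinate. -/
noncomputable def starSot (H : Type*) [NormedAddCommGroup H] [InnerProductSpace ℂ H]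
    [CompleteSpace H] : TopologicalSpace (H →L[ℂ] H) :=
  TopologicalSpace.induced
    (fun T => ((T : H → H), (ContinuousLinearMap.adjoint T : H → H))) instTopologicalSpaceProd

/-- Closure in the *-strong operator topology. -/
noncomputable def starSotClosure {H : Type*} [NormedAddCommGroup H] [InnerProductSpace ℂ H]
    [CompleteSpace H] (S : Set (H →L[ℂ] H)) : Set (H →L[ℂ] H) :=
  @closure _ (starSot H) S

/-- `B` (an operator on `G`) is, up to unitary equivalence, a reducing part of `A`: the
restriction of `A` to a closed subspace invariant under both `A` and `A*`. -/
def IsReducingPartOf {G H : Type*} [NormedAddCommGroup G] [InnerProductSpace ℂ G]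
    [NormedAddCommGroup H] [InnerProductSpace ℂ H] [CompleteSpace H]
    (B : G →L[ℂ] G) (A : H →L[ℂ] H) : Prop :=
  ∃ (M : Submodule ℂ H) (_ : IsClosed (M : Set H)) (hinv : ∀ x ∈ M, A x ∈ M)
    (_ : ∀ x ∈ M, ContinuousLinearMap.adjoint A x ∈ M),
    ∃ W : G ≃ₗᵢ[ℂ] M, opRestrict A M hinv = conjOp W B


theorem aux_nat_basis {E : Type*} [NormedAddCommGroup E] [InnerProductSpace ℂ E]
    [CompleteSpace E] [TopologicalSpace.SeparableSpace E] (h : ¬ FiniteDimensional ℂ E) :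
    Nonempty (HilbertBasis ℕ ℂ E) := by
  obtain ⟨w, b, hb⟩ := exists_hilbertBasis ℂ E
  have ho := b.orthonormal
  have hc : Countable w := by
    refine Pairwise.countable_of_isOpen_disjoint (s := fun i : w => Metric.ball (b i) (1/2)) ?_
      (fun i => Metric.isOpen_ball) (fun i => ⟨b i, Metric.mem_ball_self (by norm_num)⟩)
    intro i j hij
    apply Metric.ball_disjoint_ball
    have h1 : ‖b i - b j‖ ^ 2 = 2 := by
      rw [@norm_sub_sq ℂ, ho.1 i, ho.1 j, ho.2 hij]; norm_num
    rw [dist_eq_norm]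
    nlinarith [norm_nonneg (b i - b j)]
  have hi : Infinite w := by
    by_contra hfin
    rw [not_infinite_iff_finite] at hfin
    have := Fintype.ofFinite w
    exact h (b.toOrthonormalBasis.toBasis.finiteDimensional_of_finite)
  obtain ⟨e⟩ : Nonempty (ℕ ≃ w) := nonempty_equiv_of_countable
  refine ⟨HilbertBasis.mk (v := b ∘ e) (ho.comp e e.injective) ?_⟩
  rw [e.surjective.range_comp]
  exact b.dense_span.ge

theorem aux_hilbert_equiv {E F : Type*} [NormedAddCommGroup E] [InnerProductSpace ℂ E]
    [CompleteSpace E] [TopologicalSpace.SeparableSpace E] (h : ¬ FiniteDimensional ℂ E)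
    [NormedAddCommGroup F] [InnerProductSpace ℂ F]
    [CompleteSpace F] [TopologicalSpace.SeparableSpace F] (h' : ¬ FiniteDimensional ℂ F) :
    Nonempty (E ≃ₗᵢ[ℂ] F) := by
  obtain ⟨b⟩ := aux_nat_basis h
  obtain ⟨c⟩ := aux_nat_basis h'
  exact ⟨b.repr.trans c.repr.symm⟩

theorem aux_orth_infdim {E : Type*} [NormedAddCommGroup E] [InnerProductSpace ℂ E]
    [CompleteSpace E] (h : ¬ FiniteDimensional ℂ E) (F : Submodule ℂ E)
    [FiniteDimensional ℂ F] : ¬ FiniteDimensional ℂ Fᗮ := by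
  intro h'
  apply h
  have : FiniteDimensional ℂ (F ⊔ Fᗮ : Submodule ℂ E) := Submodule.finiteDimensional_sup _ _
  rw [Submodule.sup_orthogonal_of_hasOrthogonalProjection] at this
  exact (Submodule.topEquiv (R := ℂ) (M := E)).finiteDimensional

theorem aux_extend {H : Type*} [NormedAddCommGroup H] [InnerProductSpace ℂ H] [CompleteSpace H]
    [TopologicalSpace.SeparableSpace H] (hinf : ¬ FiniteDimensional ℂ H)
    (X : H →ₗᵢ[ℂ] H) (F : Submodule ℂ H) [FiniteDimensional ℂ F] :
    ∃ U : H ≃ₗᵢ[ℂ] H, ∀ x ∈ F, U x = X x := by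
  let G : Submodule ℂ H := F.map X.toLinearMap
  obtain ⟨S⟩ := aux_hilbert_equiv (aux_orth_infdim hinf F) (aux_orth_infdim hinf G)
  have horth : ∀ f : H, f ∈ F → ∀ g : Fᗮ, inner ℂ (X f) (S g : H) = 0 := fun f hf g =>
    Submodule.inner_right_of_mem_orthogonal (K := G) (Submodule.mem_map_of_mem (f := X.toLinearMap) hf) (S g).2
  let U0 : H →ₗ[ℂ] H := X.toLinearMap ∘ₗ F.subtype ∘ₗ (F.orthogonalProjectionOnto).toLinearMap +
    Gᗮ.subtype ∘ₗ S.toLinearEquiv.toLinearMap ∘ₗ (Fᗮ.orthogonalProjectionOnto).toLinearMap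
  have hU0 : ∀ x, U0 x = X (F.orthogonalProjectionOnto x) + S (Fᗮ.orthogonalProjectionOnto x) := fun x => rfl
  have hnorm : ∀ x, ‖U0 x‖ = ‖x‖ := by
    intro x
    have h1 : ‖U0 x‖ ^ 2 = ‖x‖ ^ 2 := by
      rw [hU0, @norm_add_sq ℂ, horth _ (Subtype.mem _), X.norm_map,
        Submodule.norm_sq_eq_add_norm_sq_projection x F, ← Submodule.coe_norm, ← Submodule.coe_norm,
        LinearIsometryEquiv.norm_map]
      simp
    exact (sq_eq_sq₀ (norm_nonneg _) (norm_nonneg _)).1 h1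
  let U1 : H →ₗᵢ[ℂ] H := ⟨U0, hnorm⟩
  have hsurj : Function.Surjective U1 := by
    intro y
    obtain ⟨f, hf, hfy⟩ := (G.orthogonalProjectionOnto y).2
    refine ⟨f + (S.symm (Gᗮ.orthogonalProjectionOnto y) : H), ?_⟩
    change U0 _ = y
    rw [hU0]
    have e1 : F.orthogonalProjectionOnto (f + (S.symm (Gᗮ.orthogonalProjectionOnto y) : H)) = ⟨f, hf⟩ := by
      rw [map_add]
      have := Submodule.orthogonalProjectionOnto_mem_subspace_eq_self (K := F) ⟨f, hf⟩
      have h2 := Submodule.orthogonalProjectionOnto_eq_zero_iff.2 (S.symm (Gᗮ.orthogonalProjectionOnto y)).2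
      rw [h2, add_zero]; exact this
    have e2 : Fᗮ.orthogonalProjectionOnto (f + (S.symm (Gᗮ.orthogonalProjectionOnto y) : H)) =
        S.symm (Gᗮ.orthogonalProjectionOnto y) := by
      rw [map_add]
      have h2 := Submodule.orthogonalProjectionOnto_mem_subspace_eq_self (K := Fᗮ) (S.symm (Gᗮ.orthogonalProjectionOnto y))
      have h3 : Fᗮ.orthogonalProjectionOnto f = 0 :=
        Submodule.orthogonalProjectionOnto_eq_zero_iff.2
          (F.le_orthogonal_orthogonal hf)
      rw [h2, h3, zero_add]
    rw [e1, e2, S.apply_symm_apply]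
    have : X f = (G.orthogonalProjectionOnto y : H) := hfy
    rw [this]
    exact G.starProjection_add_starProjection_orthogonal y
  refine ⟨LinearIsometryEquiv.ofSurjective U1 hsurj, fun x hx => ?_⟩
  change U0 x = X x
  rw [hU0, Submodule.orthogonalProjectionOnto_eq_zero_iff.2
          (F.le_orthogonal_orthogonal hx)]
  have := Submodule.orthogonalProjectionOnto_mem_subspace_eq_self (K := F) ⟨x, hx⟩
  simp only at this
  rw [this]; simp


theorem conjOp_apply {H₁ H₂ : Type*} [NormedAddCommGroup H₁] [InnerProductSpace ℂ H₁]
    [NormedAddCommGroup H₂] [InnerProductSpace ℂ H₂]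
    (W : H₁ ≃ₗᵢ[ℂ] H₂) (T : H₁ →L[ℂ] H₁) (x : H₂) : conjOp W T x = W (T (W.symm x)) := rfl

theorem conjOp_adjoint {H₁ H₂ : Type*} [NormedAddCommGroup H₁] [InnerProductSpace ℂ H₁]
    [NormedAddCommGroup H₂] [InnerProductSpace ℂ H₂] [CompleteSpace H₁] [CompleteSpace H₂]
    (W : H₁ ≃ₗᵢ[ℂ] H₂) (T : H₁ →L[ℂ] H₁) : adjoint (conjOp W T) = conjOp W (adjoint T) := by
  symm
  rw [eq_adjoint_iff]
  intro x y
  rw [conjOp_apply, conjOp_apply, LinearIsometryEquiv.inner_map_eq_flip, adjoint_inner_left,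
    LinearIsometryEquiv.inner_map_eq_flip W.symm, LinearIsometryEquiv.symm_symm]

theorem reducing_of_isometry {H : Type*} [NormedAddCommGroup H] [InnerProductSpace ℂ H]
    [CompleteSpace H] (B A : H →L[ℂ] H) (X : H →ₗᵢ[ℂ] H) (h1 : ∀ x, X (B x) = A (X x))
    (h2 : ∀ x, X (adjoint B x) = adjoint A (X x)) : IsReducingPartOf B A := by
  have m1 : ∀ x ∈ LinearMap.range X.toLinearMap, A x ∈ LinearMap.range X.toLinearMap := by
    rintro _ ⟨x, rfl⟩; exact ⟨B x, h1 x⟩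
  have m2 : ∀ x ∈ LinearMap.range X.toLinearMap, adjoint A x ∈ LinearMap.range X.toLinearMap := by
    rintro _ ⟨x, rfl⟩; exact ⟨adjoint B x, h2 x⟩
  refine ⟨LinearMap.range X.toLinearMap, ?_, m1, m2, X.equivRange, ?_⟩
  · have := X.isometry.isClosedEmbedding.isClosed_range
    exact this
  · ext ⟨_, x, rfl⟩
    have e : (X.equivRange.symm ⟨X.toLinearMap x, ⟨x, rfl⟩⟩) = x := by
      rw [LinearIsometryEquiv.symm_apply_eq]; rfl
    rw [conjOp_apply, e]
    exact (h1 x).symm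

theorem isometry_of_reducing {H : Type*} [NormedAddCommGroup H] [InnerProductSpace ℂ H]
    [CompleteSpace H] (B A : H →L[ℂ] H) (h : IsReducingPartOf B A) :
    ∃ (X : H →ₗᵢ[ℂ] H), (∀ x, X (B x) = A (X x)) ∧ (∀ x, X (adjoint B x) = adjoint A (X x)) := by
  obtain ⟨M, hMc, m1, m2, W, hW⟩ := h
  have : CompleteSpace M := hMc.completeSpace_coe
  have k1 : ∀ x, (W (B x) : H) = A (W x) := by
    intro x
    have := congrArg (fun f => ((f (W x) : M) : H)) hW
    simp only [conjOp_apply, W.symm_apply_apply] at this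
    exact this.symm
  refine ⟨M.subtypeₗᵢ.comp W.toLinearIsometry, k1, ?_⟩
  intro x
  change (W (adjoint B x) : H) = adjoint A (W x)
  have : W (adjoint B x) = ⟨adjoint A (W x), m2 _ (W x).2⟩ := by
    refine ext_inner_right ℂ fun v => ?_
    obtain ⟨z, rfl⟩ := W.surjective v
    rw [W.inner_map_map, adjoint_inner_left]
    change _ = inner ℂ (adjoint A (W x)) (W z : H)
    rw [adjoint_inner_left, ← k1, ← W.inner_map_map]; rfl
  rw [this]

theorem starSot_tendsto {H : Type*} [NormedAddCommGroup H] [InnerProductSpace ℂ H]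
    [CompleteSpace H] {ι : Type*} {l : Filter ι} {f : ι → H →L[ℂ] H} {B : H →L[ℂ] H} :
    Tendsto f l (@nhds _ (starSot H) B) ↔ (∀ x, Tendsto (fun i => f i x) l (𝓝 (B x))) ∧
      (∀ x, Tendsto (fun i => adjoint (f i) x) l (𝓝 (adjoint B x))) := by
  unfold starSot
  rw [nhds_induced, tendsto_comap_iff, nhds_prod_eq, tendsto_prod_iff', tendsto_pi_nhds,
    tendsto_pi_nhds]
  rfl

theorem easy_dir {H : Type*} [NormedAddCommGroup H] [InnerProductSpace ℂ H] [CompleteSpace H]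
    [TopologicalSpace.SeparableSpace H] (hinf : ¬ FiniteDimensional ℂ H)
    (T A B : H →L[ℂ] H) (hA : A ∈ closure (unitaryOrbit T)) (h : IsReducingPartOf B A) :
    B ∈ starSotClosure (unitaryOrbit T) := by
  obtain ⟨X, h1, h2⟩ := isometry_of_reducing B A h
  -- conjugates of A lie in the star-SOT closure
  have hconj : ∀ U : H ≃ₗᵢ[ℂ] H, conjOp U A ∈ starSotClosure (unitaryOrbit T) := by
    intro U
    obtain ⟨u, hu, hlim⟩ := mem_closure_iff_seq_limit.1 hA
    unfold starSotClosure
    refine @mem_closure_of_tendsto _ (starSot H) _ _ _ (fun n => conjOp U (u n)) atTop _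
      (starSot_tendsto.2 ⟨fun x => ?_, fun x => ?_⟩) (Eventually.of_forall fun n => ?_)
    · have : Tendsto (fun n => u n (U.symm x)) atTop (𝓝 (A (U.symm x))) :=
        ((ContinuousLinearMap.apply ℂ H (U.symm x)).continuous.tendsto A).comp hlim
      exact (U.continuous.tendsto _).comp this
    · have : Tendsto (fun n => adjoint (u n) (U.symm x)) atTop (𝓝 (adjoint A (U.symm x))) :=
        ((ContinuousLinearMap.apply ℂ H (U.symm x)).continuous.tendsto _).comp
          (((adjoint (𝕜 := ℂ) (E := H) (F := H)).continuous.tendsto A).comp hlim)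
      simp only [conjOp_adjoint]
      exact (U.continuous.tendsto _).comp this
    · obtain ⟨W, hW⟩ := hu n
      exact ⟨W.trans U, by rw [hW]; rfl⟩
  have key : ∀ s : Finset H, ∃ C ∈ starSotClosure (unitaryOrbit T), ∀ x ∈ s, C x = B x ∧
      adjoint C x = adjoint B x := by
    intro s
    classical
    let F := Submodule.span ℂ ((s ∪ s.image B ∪ s.image (adjoint B) : Finset H) : Set H)
    obtain ⟨U, hU⟩ := aux_extend hinf X F
    have hF : ∀ x ∈ s, x ∈ F ∧ B x ∈ F ∧ adjoint B x ∈ F := by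
      intro x hx
      refine ⟨Submodule.subset_span ?_, Submodule.subset_span ?_, Submodule.subset_span ?_⟩
      · simp [hx]
      · have : ∃ a ∈ s, B a = B x := ⟨x, hx, rfl⟩
        simp [this]
      · have : ∃ a ∈ s, adjoint B a = adjoint B x := ⟨x, hx, rfl⟩
        simp [this]
    refine ⟨conjOp U.symm A, hconj _, fun x hx => ?_⟩
    obtain ⟨a, b, c⟩ := hF x hx
    rw [conjOp_adjoint, conjOp_apply, conjOp_apply, LinearIsometryEquiv.symm_symm, hU x a, ← h1,
      ← h2, ← hU _ b, ← hU _ c]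
    simp
  choose C hC hCB using key
  have : B ∈ @closure _ (starSot H) (@closure _ (starSot H) (unitaryOrbit T)) := by
    refine @mem_closure_of_tendsto _ (starSot H) _ _ _ C atTop _
      (starSot_tendsto.2 ⟨fun x => ?_, fun x => ?_⟩) (Eventually.of_forall fun n => hC n)
    · refine tendsto_const_nhds.congr' ?_
      filter_upwards [eventually_ge_atTop {x}] with s hs
      exact ((hCB s x (by simpa using hs)).1).symm
    · refine tendsto_const_nhds.congr' ?_
      filter_upwards [eventually_ge_atTop {x}] with s hs
      exact ((hCB s x (by simpa using hs)).2).symm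
  rwa [@closure_closure _ (starSot H)] at this


theorem fd_unif {K G ι : Type*} [NormedAddCommGroup K] [InnerProductSpace ℂ K]
    [NormedAddCommGroup G] [NormedSpace ℂ G] {l : Filter ι} (F : Submodule ℂ K)
    [FiniteDimensional ℂ F] (Φ : ι → K →ₗ[ℂ] G) (h : ∀ x, Tendsto (fun i => Φ i x) l (𝓝 0))
    (η : ℝ) (hη : 0 < η) : ∀ᶠ i in l, ∀ x ∈ F, ‖Φ i x‖ ≤ η * ‖x‖ := by
  let b := stdOrthonormalBasis ℂ F
  have h1 : Tendsto (fun i => ∑ m, ‖Φ i (b m)‖) l (𝓝 0) := by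
    have : Tendsto (fun i => ∑ m, ‖Φ i (b m)‖) l (𝓝 (∑ m : Fin (Module.finrank ℂ F), 0)) :=
      tendsto_finsetSum _ fun m _ => by simpa using (h (b m)).norm
    simpa using this
  filter_upwards [h1.eventually (gt_mem_nhds hη)] with i hi x hx
  have hx' : x = ∑ m, (inner ℂ (b m) (⟨x, hx⟩ : F)) • (b m : K) := by
    have := congrArg (Subtype.val) (b.sum_repr' ⟨x, hx⟩)
    simpa using this.symm
  have : ‖Φ i x‖ ≤ ∑ m, ‖x‖ * ‖Φ i (b m)‖ := by
    conv_lhs => rw [hx', map_sum]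
    refine (norm_sum_le _ _).trans (Finset.sum_le_sum fun m _ => ?_)
    rw [map_smul, norm_smul]
    gcongr
    refine (norm_inner_le_norm _ _).trans ?_
    rw [b.norm_eq_one, one_mul]; rfl
  rw [← Finset.mul_sum] at this
  nlinarith [norm_nonneg x]

theorem near_isometry {F H : Type*} [NormedAddCommGroup F] [InnerProductSpace ℂ F]
    [CompleteSpace F] [NormedAddCommGroup H] [InnerProductSpace ℂ H] [CompleteSpace H]
    (Θ : F →L[ℂ] H) (δ : ℝ) (hδ : δ ≤ 1/2) (h : ‖adjoint Θ ∘L Θ - 1‖ ≤ δ) :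
    ∃ G : F →L[ℂ] F, (∀ x, ‖Θ (G x)‖ = ‖x‖) ∧ ‖G - 1‖ ≤ 2 * δ := by
  have hδ0 : 0 ≤ δ := (norm_nonneg _).trans h
  set a : F →L[ℂ] F := adjoint Θ ∘L Θ with ha
  have hsa : IsSelfAdjoint a := IsSelfAdjoint.adjoint_conj (T := (1 : H →L[ℂ] H)) (.one _) Θ
  have hspec : ∀ x ∈ spectrum ℝ a, |x - 1| ≤ δ := by
    intro x hx
    have h1 : cfc (fun x : ℝ => x - 1) a = a - 1 := by
      rw [cfc_sub (fun x : ℝ => x) (fun _ => 1) a, cfc_id' ℝ a, cfc_const_one ℝ a]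
    have := norm_apply_le_norm_cfc (fun x : ℝ => x - 1) a hx
    rw [h1] at this
    exact this.trans h
  have hpos : ∀ x ∈ spectrum ℝ a, 1/2 ≤ x := by
    intro x hx
    have := (abs_le.1 (hspec x hx)).1
    linarith
  let g : ℝ → ℝ := fun x => (√x)⁻¹
  have hgc : ContinuousOn g (spectrum ℝ a) := by
    intro x hx
    refine ContinuousAt.continuousWithinAt ?_
    refine Real.continuous_sqrt.continuousAt.inv₀ ?_
    have := hpos x hx
    exact (Real.sqrt_pos.2 (by linarith)).ne'
  let G := cfc g a
  have hG : IsSelfAdjoint G := cfc_predicate g a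
  have hGG : G * a * G = 1 := by
    have e1 : G * a = cfc (fun x => g x * x) a := by
      rw [cfc_mul g (fun x => x) a, cfc_id' ℝ a]
    rw [e1, ← cfc_mul (fun x => g x * x) g a, ← cfc_one ℝ a]
    refine cfc_congr fun x hx => ?_
    have := hpos x hx
    have h2 := Real.sq_sqrt (show 0 ≤ x by linarith)
    have h3 : √x ≠ 0 := (Real.sqrt_pos.2 (by linarith)).ne'
    simp only [g, Pi.one_apply]
    field_simp
    exact h2.symm
  refine ⟨G, fun x => ?_, ?_⟩
  · have : ‖Θ (G x)‖ ^ 2 = ‖x‖ ^ 2 := by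
      rw [← @inner_self_eq_norm_sq ℂ, ← @inner_self_eq_norm_sq ℂ, ← adjoint_inner_left]
      have : inner ℂ (adjoint Θ (Θ (G x))) (G x) = inner ℂ ((G * a * G) x) x := by
        exact (ContinuousLinearMap.isSelfAdjoint_iff_isSymmetric.1 hG (a (G x)) x).symm
      rw [this, hGG]; rfl
    exact (sq_eq_sq₀ (norm_nonneg _) (norm_nonneg _)).1 this
  · have e : G - 1 = cfc (fun x => g x - 1) a := by
      rw [cfc_sub g (fun _ => 1) a, cfc_const_one ℝ a]
    rw [e]
    refine norm_cfc_le (by linarith) fun x hx => ?_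
    have h1 := hpos x hx
    have h2 := Real.sq_sqrt (show 0 ≤ x by linarith)
    have h3 : 1/2 ≤ √x := Real.le_sqrt_of_sq_le (by norm_num; linarith)
    have h4 := hspec x hx
    have h5 : x - 1 = (√x - 1) * (√x + 1) := by ring_nf; linarith
    rw [h5, abs_mul, abs_of_pos (show 0 < √x + 1 by linarith)] at h4
    have h6 : g x - 1 = -(√x - 1) / √x := by
      simp only [g]; field_simp; ring
    rw [h6, Real.norm_eq_abs, abs_div, abs_neg, abs_of_pos (show 0 < √x by linarith), div_le_iff₀ (by linarith)]
    nlinarith [abs_nonneg (√x - 1)]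

theorem weak_null_proj {H ι : Type*} [NormedAddCommGroup H] [InnerProductSpace ℂ H]
    {l : Filter ι} (N : Submodule ℂ H) [FiniteDimensional ℂ N] (v : ι → H)
    (h : ∀ y, Tendsto (fun i => inner ℂ y (v i)) l (𝓝 0)) :
    Tendsto (fun i => N.starProjection (v i)) l (𝓝 0) := by
  let b := stdOrthonormalBasis ℂ N
  have e : ∀ i, N.starProjection (v i) = ∑ m, inner ℂ (b m : H) (v i) • (b m : H) := by
    intro i
    have := congrArg Subtype.val (b.orthogonalProjectionOnto_apply_eq_sum (v i))
    simpa using this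
  simp only [e]
  have : Tendsto (fun i => ∑ m, inner ℂ (b m : H) (v i) • (b m : H)) l
      (𝓝 (∑ m : Fin (Module.finrank ℂ N), (0 : ℂ) • (b m : H))) :=
    tendsto_finsetSum _ fun m _ => (h (b m)).smul_const _
  simpa using this

theorem step {H K ι : Type*} [NormedAddCommGroup H] [InnerProductSpace ℂ H] [CompleteSpace H]
    [NormedAddCommGroup K] [InnerProductSpace ℂ K] [CompleteSpace K]
    (T : H →L[ℂ] H) (B : K →L[ℂ] K) (l : Filter ι) [NeBot l] (Z : ι → K →ₗᵢ[ℂ] H)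
    (hw : ∀ x y, Tendsto (fun i => inner ℂ y (Z i x)) l (𝓝 0))
    (h1 : ∀ x, Tendsto (fun i => T (Z i x) - Z i (B x)) l (𝓝 0))
    (h2 : ∀ x, Tendsto (fun i => adjoint T (Z i x) - Z i (adjoint B x)) l (𝓝 0))
    (F : Submodule ℂ K) [FiniteDimensional ℂ F] (N : Submodule ℂ H) [FiniteDimensional ℂ N]
    (η : ℝ) (hη : 0 < η) :
    ∃ Y : F →ₗᵢ[ℂ] H, (∀ x, Y x ∈ Nᗮ) ∧
      (∀ x y : F, (y : K) = B x → ‖T (Y x) - Y y‖ ≤ η * ‖x‖) ∧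
      (∀ x y : F, (y : K) = adjoint B x → ‖adjoint T (Y x) - Y y‖ ≤ η * ‖x‖) := by
  obtain ⟨s, hs0, hs1, hs2⟩ : ∃ s : ℝ, 0 < s ∧ s ≤ 1/2 ∧
      s + 3 * s * (‖T‖ + ‖B‖) ≤ η := by
    refine ⟨min (1/2) (η / (1 + 3 * (‖T‖ + ‖B‖))), by positivity, min_le_left _ _, ?_⟩
    have h := min_le_right (1/2) (η / (1 + 3 * (‖T‖ + ‖B‖)))
    rw [le_div_iff₀ (by positivity)] at h
    linarith
  have hp := fd_unif F (fun i => N.starProjection.toLinearMap ∘ₗ (Z i).toLinearMap)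
    (fun x => weak_null_proj N _ (hw x)) s hs0
  have ht := fd_unif F (fun i => T.toLinearMap ∘ₗ (Z i).toLinearMap - (Z i).toLinearMap ∘ₗ B.toLinearMap) h1 s hs0
  have hta := fd_unif F (fun i => (adjoint T).toLinearMap ∘ₗ (Z i).toLinearMap -
    (Z i).toLinearMap ∘ₗ (adjoint B).toLinearMap) h2 s hs0
  obtain ⟨i, hp, ht, hta⟩ := (hp.and (ht.and hta)).exists
  let z : F →L[ℂ] H := (Z i).toContinuousLinearMap ∘L F.subtypeL
  have hz : ∀ x, ‖z x‖ = ‖x‖ := fun x => (Z i).norm_map x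
  let p : F →L[ℂ] H := N.starProjection ∘L z
  have hpn : ‖p‖ ≤ s := opNorm_le_bound _ hs0.le fun x => hp x x.2
  let Θ : F →L[ℂ] H := z - p
  have hΘN : ∀ x, Θ x ∈ Nᗮ := fun x => N.sub_starProjection_mem_orthogonal (z x)
  have hΘ : ‖adjoint Θ ∘L Θ - 1‖ ≤ s ^ 2 := by
    have : adjoint Θ ∘L Θ - 1 = - (adjoint p ∘L p) := by
      ext1 x
      refine ext_inner_right ℂ fun y => ?_
      simp only [sub_apply, comp_apply, neg_apply, inner_sub_left, inner_neg_left,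
        adjoint_inner_left, one_apply_eq_self]
      have e1 : z x = Θ x + p x := by simp [Θ]
      have e2 : z y = Θ y + p y := by simp [Θ]
      have e3 : inner ℂ (z x) (z y) = inner ℂ x y := (Z i).inner_map_map x y
      have e4 : inner ℂ (Θ x) (p y) = 0 :=
        Submodule.inner_left_of_mem_orthogonal (Submodule.starProjection_apply_mem N _) (hΘN x)
      have e5 : inner ℂ (p x) (Θ y) = 0 :=
        Submodule.inner_right_of_mem_orthogonal (Submodule.starProjection_apply_mem N _) (hΘN y)
      rw [← e3, e1, e2, inner_add_left, inner_add_right, inner_add_right, e4, e5]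
      simp
    have h' : ‖adjoint p ∘L p‖ = ‖p‖ * ‖p‖ := ContinuousLinearMap.norm_adjoint_comp_self p
    rw [this]
    refine (norm_neg (adjoint p ∘L p)).trans_le ?_
    nlinarith [norm_nonneg p]
  have hs3 : s ^ 2 ≤ s / 2 := by nlinarith
  obtain ⟨G, hG1, hG2⟩ := near_isometry Θ (s ^ 2) (by nlinarith) hΘ
  have hΘ1 : ∀ x, ‖Θ x‖ ≤ ‖x‖ := by
    intro x
    have := N.norm_sq_eq_add_norm_sq_projection (z x)
    have e : ‖Θ x‖ ≤ ‖z x‖ := by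
      have e1 : Θ x = Nᗮ.starProjection (z x) := by
        rw [Submodule.starProjection_orthogonal]; rfl
      rw [e1]; exact Submodule.norm_starProjection_apply_le _ _
    rwa [hz] at e
  let Y : F →ₗᵢ[ℂ] H := ⟨(Θ ∘L G).toLinearMap, hG1⟩
  have hYz : ∀ x, ‖Y x - z x‖ ≤ 2 * s * ‖x‖ := by
    intro x
    have e : Y x - z x = Θ ((G - 1) x) - p x := by
      change Θ (G x) - z x = _
      have : Θ ((G - 1) x) = Θ (G x) - Θ x := by
        rw [← map_sub]; rfl
      rw [this]
      simp only [Θ, sub_apply]; abel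
    rw [e]
    have a1 : ‖Θ ((G - 1) x)‖ ≤ s * ‖x‖ := (hΘ1 _).trans ((le_opNorm _ _).trans (by
      gcongr; linarith))
    have a2 : ‖p x‖ ≤ s * ‖x‖ := (le_opNorm _ _).trans (by gcongr)
    linarith [norm_sub_le (Θ ((G - 1) x)) (p x)]
  have fin : ∀ (T' : H →L[ℂ] H) (B' : K →L[ℂ] K), ‖T'‖ = ‖T‖ → ‖B'‖ = ‖B‖ →
      (∀ x ∈ F, ‖T' (Z i x) - Z i (B' x)‖ ≤ s * ‖x‖) →
      (∀ x y : F, (y : K) = B' x → ‖T' (Y x) - Y y‖ ≤ η * ‖x‖) := by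
    intro T' B' hT' hB' hh x y hy
    have e : T' (Y x) - Y y = T' (Y x - z x) + (T' (Z i x) - Z i (B' x)) - (Y y - z y) := by
      have : z y = Z i (B' x) := by rw [← hy]; rfl
      have h' : z x = Z i x := rfl
      rw [this, map_sub, h']; abel
    have a1 : ‖T' (Y x - z x)‖ ≤ ‖T‖ * (2 * s * ‖x‖) := by
      rw [← hT']; exact (le_opNorm _ _).trans (by gcongr; exact hYz x)
    have a2 := hh x x.2
    have a3 : ‖Y y - z y‖ ≤ 2 * s * (‖B‖ * ‖x‖) := by
      refine (hYz y).trans ?_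
      gcongr
      rw [← hB', Submodule.coe_norm, hy]; exact le_opNorm _ _
    rw [e]
    have a4 := norm_sub_le (T' (Y x - z x) + (T' (Z i x) - Z i (B' x))) (Y y - z y)
    have a5 := norm_add_le (T' (Y x - z x)) (T' (Z i x) - Z i (B' x))
    have a6 : (s + 3 * s * (‖T‖ + ‖B‖)) * ‖x‖ ≤ η * ‖x‖ := by gcongr
    have a7 : 0 ≤ s * ‖x‖ * ‖T‖ := by positivity
    have a8 : 0 ≤ s * ‖x‖ * ‖B‖ := by positivity
    have a9 : ‖(x : K)‖ = ‖x‖ := rfl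
    rw [a9] at a2
    nlinarith
  exact ⟨Y, fun x => hΘN _, fin T B rfl rfl ht,
    fin (adjoint T) (adjoint B) (LinearIsometryEquiv.norm_map _ _) (LinearIsometryEquiv.norm_map _ _) hta⟩


theorem scalar_partition (ε : ℝ) (hε : 0 < ε) : ∃ f : ℕ → ℕ → ℝ,
    (∀ k, ∃ M, ∀ n ≥ M, f k n = 0) ∧ (∀ k n, |f k n - f k (n+1)| ≤ ε * (1/2)^k) ∧
    (∀ n, HasSum (fun k => (f k n)^2) 1) := by
  obtain ⟨N, hN1, hN2⟩ : ∃ N : ℝ, 1 ≤ N ∧ 2 * Real.exp 2 / N ≤ ε := by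
    refine ⟨max 1 (2 * Real.exp 2 / ε), le_max_left _ _, ?_⟩
    rw [div_le_iff₀ (by positivity)]
    have := le_max_right 1 (2 * Real.exp 2 / ε)
    rw [div_le_iff₀ hε] at this
    linarith
  let θ : ℕ → ℝ := fun n => Real.log ((N + n) / N)
  have hNn : ∀ n : ℕ, 0 < N + n := fun n => by positivity
  have hN0 : 0 < N := by linarith
  have hexp : ∀ n, Real.exp (θ n) = (N + n) / N := fun n => Real.exp_log (div_pos (hNn n) hN0)
  have hθ0 : ∀ n, 0 ≤ θ n := fun n => Real.log_nonneg (by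
    rw [le_div_iff₀ hN0]; have : (0:ℝ) ≤ n := by positivity
    linarith)
  have hθmono : ∀ n, θ n ≤ θ (n+1) := fun n => by
    apply Real.log_le_log (div_pos (hNn n) hN0)
    push_cast; gcongr; linarith
  have hθinc : ∀ n, θ (n+1) - θ n ≤ Real.exp (-θ n) / N := by
    intro n
    have h1 : θ (n+1) - θ n = Real.log ((N + (n+1)) / (N + n)) := by
      simp only [θ]
      rw [← Real.log_div]
      · congr 1
        have := hNn n
        push_cast
        field_simp
      · push_cast; have := hNn n; positivity
      · have := hNn n; positivity
    rw [h1, Real.exp_neg, hexp]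
    refine (Real.log_le_sub_one_of_pos ?_).trans ?_
    · have := hNn n; positivity
    · have := hNn n
      apply le_of_eq; field_simp; ring
  have hθtop : Tendsto θ atTop atTop := by
    apply Real.tendsto_log_atTop.comp
    apply Tendsto.atTop_div_const hN0
    exact tendsto_atTop_add_const_left _ _ tendsto_natCast_atTop_atTop
  let g : ℝ → ℝ := fun t => Real.cos (Real.pi / 2 * min |t| 1)
  have hg0 : ∀ t, 1 ≤ |t| → g t = 0 := fun t ht => by
    simp only [g, min_eq_right ht, mul_one, Real.cos_pi_div_two]
  have hglip : ∀ s t, |g s - g t| ≤ 2 * |s - t| := by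
    intro s t
    have h1 : |g s - g t| ≤ |Real.pi / 2 * min |s| 1 - Real.pi / 2 * min |t| 1| := by
      have := Real.lipschitzWith_cos.dist_le_mul (Real.pi / 2 * min |s| 1) (Real.pi / 2 * min |t| 1)
      simpa [Real.dist_eq] using this
    rw [← mul_sub, abs_mul, abs_of_pos (show 0 < Real.pi / 2 by positivity)] at h1
    have h2 : |min |s| 1 - min |t| 1| ≤ |s - t| := by
      refine (abs_min_sub_min_le_max _ _ _ _).trans ?_
      simp only [sub_self, abs_zero]
      exact max_le (abs_abs_sub_abs_le _ _) (abs_nonneg _)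
    have h3 := Real.pi_le_four
    nlinarith [abs_nonneg (min |s| 1 - min |t| 1)]
  refine ⟨fun k n => g (θ n - k), fun k => ?_, fun k n => ?_, fun n => ?_⟩
  · obtain ⟨M, hM⟩ := eventually_atTop.1 (hθtop.eventually_ge_atTop ((k : ℝ) + 1))
    refine ⟨M, fun n hn => hg0 _ ?_⟩
    have := hM n hn
    rw [abs_of_nonneg (by linarith)]; linarith
  · by_cases hc : θ (n+1) ≤ k - 1
    · have := hθmono n
      show |g (θ n - k) - g (θ (n+1) - k)| ≤ _
      rw [hg0, hg0]
      · simp; positivity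
      · rw [abs_of_nonpos (by linarith)]; linarith
      · rw [abs_of_nonpos (by linarith)]; linarith
    · push Not at hc
      refine (hglip _ _).trans ?_
      have h1 : |θ n - k - (θ (n+1) - k)| = θ (n+1) - θ n := by
        rw [abs_of_nonpos (by linarith [hθmono n])]; ring
      rw [h1]
      have h2 := hθinc n
      have h3 : Real.exp (-θ n) / N ≤ 1 := by
        rw [div_le_iff₀ hN0]
        have := Real.exp_le_one_iff.2 (neg_nonpos.2 (hθ0 n))
        linarith
      have h4 : Real.exp (-θ n) ≤ Real.exp 2 * (1/2)^k := by
        have h5 : Real.exp (-θ n) ≤ Real.exp (2 + -k) := Real.exp_le_exp.2 (by linarith)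
        rw [Real.exp_add] at h5
        refine h5.trans ?_
        gcongr
        rw [show -(k:ℝ) = (k:ℝ) * (-1) by ring, Real.exp_nat_mul]
        gcongr
        rw [Real.exp_neg, one_div]
        gcongr
        linarith [Real.add_one_le_exp (1:ℝ)]
      calc 2 * (θ (n+1) - θ n) ≤ 2 * (Real.exp 2 * (1/2)^k / N) := by
            gcongr; exact h2.trans (by gcongr)
        _ = (2 * Real.exp 2 / N) * (1/2)^k := by ring
        _ ≤ _ := by gcongr
  · set m := ⌊θ n⌋₊ with hm
    have a1 : (m : ℝ) ≤ θ n := Nat.floor_le (hθ0 n)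
    have a2 : θ n < m + 1 := Nat.lt_floor_add_one _
    have hs : (1:ℝ) = ∑ k ∈ ({m, m+1} : Finset ℕ), (g (θ n - k))^2 := by
      rw [Finset.sum_pair (by simp)]
      have b1 : g (θ n - m) = Real.cos (Real.pi / 2 * (θ n - m)) := by
        simp only [g]; rw [abs_of_nonneg (by linarith), min_eq_left (by linarith)]
      have b2 : g (θ n - (m + 1 : ℕ)) = Real.sin (Real.pi / 2 * (θ n - m)) := by
        simp only [g]; push_cast
        rw [abs_of_nonpos (by linarith), min_eq_left (by linarith), ← Real.cos_pi_div_two_sub]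
        congr 1; ring
      rw [b1, b2, Real.cos_sq_add_sin_sq]
    rw [hs]
    apply hasSum_sum_of_ne_finset_zero
    intro k hk
    simp only [Finset.mem_insert, Finset.mem_singleton, not_or] at hk
    show g (θ n - k)^2 = 0
    rw [hg0]
    · simp
    rcases lt_or_gt_of_ne hk.1 with h | h
    · have : (k:ℝ) + 1 ≤ m := by exact_mod_cast h
      rw [abs_of_nonneg (by linarith)]; linarith
    · have : (m:ℝ) + 1 + 1 ≤ k := by
        have : m + 1 + 1 ≤ k := by omega
        exact_mod_cast this
      rw [abs_of_nonpos (by linarith)]; linarith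


section
variable {K : Type*} [NormedAddCommGroup K] [InnerProductSpace ℂ K] [CompleteSpace K]

theorem pq_sq (P : ℕ → Submodule ℂ K) [∀ n, FiniteDimensional ℂ (P n)] (hm : Monotone P)
    (n : ℕ) (x : K) :
    ‖(P (n+1)).starProjection x - (P n).starProjection x‖^2 =
      ‖(P (n+1)).starProjection x‖^2 - ‖(P n).starProjection x‖^2 := by
  have h1 : (P (n+1)).starProjection ((P n).starProjection x) = (P n).starProjection x :=
    Submodule.starProjection_eq_self_iff.2 (hm (Nat.le_succ n) (Submodule.starProjection_apply_mem _ _))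
  have h2 : (P n).starProjection ((P n).starProjection x) = (P n).starProjection x :=
    Submodule.starProjection_eq_self_iff.2 (Submodule.starProjection_apply_mem _ _)
  have h3 : inner ℂ ((P (n+1)).starProjection x) ((P n).starProjection x) =
      inner ℂ ((P n).starProjection x) ((P n).starProjection x) := by
    rw [Submodule.inner_starProjection_left_eq_right, h1,
      Submodule.inner_starProjection_left_eq_right, h2]
  rw [@norm_sub_sq ℂ, h3, inner_self_eq_norm_sq_to_K]
  norm_cast
  ring

theorem pq_sum (P : ℕ → Submodule ℂ K) [∀ n, FiniteDimensional ℂ (P n)] (hm : Monotone P)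
    (a M : ℕ) (x : K) :
    ∑ n ∈ Finset.range M, ‖(P (n+a+1)).starProjection x - (P (n+a)).starProjection x‖^2 ≤ ‖x‖^2 := by
  have : ∑ n ∈ Finset.range M, ‖(P (n+a+1)).starProjection x - (P (n+a)).starProjection x‖^2
      = ‖(P (M+a)).starProjection x‖^2 - ‖(P (0+a)).starProjection x‖^2 := by
    rw [← Finset.sum_range_sub (fun n => ‖(P (n+a)).starProjection x‖^2)]
    refine Finset.sum_congr rfl fun n _ => ?_
    rw [pq_sq P hm, show n + 1 + a = n + a + 1 by ring]
  rw [this]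
  have h := (P (M+a)).norm_starProjection_apply_le x
  nlinarith [norm_nonneg ((P (M+a)).starProjection x), sq_nonneg ‖(P (0+a)).starProjection x‖]

set_option maxHeartbeats 1000000 in
theorem comm_bound (P : ℕ → Submodule ℂ K) [∀ n, FiniteDimensional ℂ (P n)] (hm : Monotone P)
    (h0 : P 0 = ⊥) (B : K →L[ℂ] K) (hB : ∀ n, ∀ x ∈ P n, B x ∈ P (n+1))
    (hB' : ∀ n, ∀ x ∈ P n, adjoint B x ∈ P (n+1)) (f : ℕ → ℝ) (M : ℕ) (hM : f M = 0)
    (δ : ℝ) (hf : ∀ n, |f n - f (n+1)| ≤ δ) (E : K →L[ℂ] K)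
    (hE : ∀ x, E x = ∑ n ∈ Finset.range M, ((f n : ℝ) : ℂ) •
      ((P (n+1)).starProjection x - (P n).starProjection x)) (x : K) :
    ‖E (B x) - B (E x)‖ ≤ 2 * δ * ‖B‖ * ‖x‖ := by
  have hδ : 0 ≤ δ := (abs_nonneg _).trans (hf 0)
  have hE2 : ∀ x, E x = ∑ n ∈ Finset.range M, ((f n - f (n+1) : ℝ) : ℂ) • (P (n+1)).starProjection x := by
    intro x
    have h := Finset.sum_range_sub (fun n => ((f n : ℝ) : ℂ) • (P n).starProjection x) M
    have hz0 : ∀ z ∈ P 0, z = 0 := by rw [h0]; simp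
    have e0 : (P 0).starProjection x = 0 := hz0 _ (Submodule.starProjection_apply_mem _ _)
    simp only [hM, e0] at h
    simp only [Complex.ofReal_zero, zero_smul, smul_zero, sub_self] at h
    rw [hE, ← sub_zero (∑ n ∈ Finset.range M, ((f n : ℝ) : ℂ) • _), ← h, ← Finset.sum_sub_distrib]
    refine Finset.sum_congr rfl fun n _ => ?_
    push_cast
    module
  have hid : ∀ n x, ∀ z ∈ P n, inner ℂ z ((P n).starProjection x) = inner ℂ z x := by
    intro n x z hz
    rw [← Submodule.inner_starProjection_left_eq_right, Submodule.starProjection_eq_self_iff.2 hz]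
  have hid' : ∀ n x, ∀ z ∈ P n, inner ℂ ((P n).starProjection x) z = inner ℂ x z := by
    intro n x z hz
    rw [Submodule.inner_starProjection_left_eq_right, Submodule.starProjection_eq_self_iff.2 hz]
  have hmem : ∀ n x, (P n).starProjection x ∈ P n := fun n x => Submodule.starProjection_apply_mem _ _
  have key : ∀ n (x y : K), inner ℂ y ((P (n+1)).starProjection (B x)) - inner ℂ y (B ((P (n+1)).starProjection x))
     = inner ℂ ((P (n+1)).starProjection y - (P n).starProjection y)
        (B ((P (n+1+1)).starProjection x - (P (n+1)).starProjection x))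
      - inner ℂ ((P (n+1+1)).starProjection y - (P (n+1)).starProjection y)
        (B ((P (n+1)).starProjection x - (P n).starProjection x)) := by
    intro n x y
    have a1 : inner ℂ ((P (n+1)).starProjection y) (B ((P (n+1+1)).starProjection x)) = inner ℂ y ((P (n+1)).starProjection (B x)) := by
      rw [← adjoint_inner_left, hid _ _ _ (hB' _ _ (hmem _ _)), adjoint_inner_left,
        Submodule.inner_starProjection_left_eq_right]
    have a2 : inner ℂ ((P n).starProjection y) (B ((P (n+1+1)).starProjection x)) = inner ℂ ((P n).starProjection y) (B x) := by
      rw [← adjoint_inner_left, hid _ _ _ (hm (Nat.le_succ _) (hB' _ _ (hmem _ _))), adjoint_inner_left]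
    have a3 : inner ℂ ((P n).starProjection y) (B ((P (n+1)).starProjection x)) = inner ℂ ((P n).starProjection y) (B x) := by
      rw [← adjoint_inner_left, hid _ _ _ (hB' _ _ (hmem _ _)), adjoint_inner_left]
    have a4 : inner ℂ ((P (n+1+1)).starProjection y) (B ((P (n+1)).starProjection x)) = inner ℂ y (B ((P (n+1)).starProjection x)) :=
      hid' _ _ _ (hB _ _ (hmem _ _))
    have a5 : inner ℂ ((P (n+1+1)).starProjection y) (B ((P n).starProjection x)) = inner ℂ y (B ((P n).starProjection x)) :=
      hid' _ _ _ (hm (Nat.le_succ _) (hB _ _ (hmem _ _)))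
    have a6 : inner ℂ ((P (n+1)).starProjection y) (B ((P n).starProjection x)) = inner ℂ y (B ((P n).starProjection x)) :=
      hid' _ _ _ (hB _ _ (hmem _ _))
    simp only [map_sub, inner_sub_left, inner_sub_right]
    rw [a1, a2, a3, a4, a5, a6]
    ring
  set y := E (B x) - B (E x) with hy
  let q : ℕ → K → ℝ := fun n x => ‖(P (n+1)).starProjection x - (P n).starProjection x‖
  have hqs : ∀ a x, ∑ n ∈ Finset.range M, (q (n+a) x)^2 ≤ ‖x‖^2 := fun a x => pq_sum P hm a M x
  have hcs : ∀ a b x y, ∑ n ∈ Finset.range M, q (n+a) x * q (n+b) y ≤ ‖x‖ * ‖y‖ := by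
    intro a b x y
    refine (Real.sum_mul_le_sqrt_mul_sqrt _ _ _).trans ?_
    exact mul_le_mul (Real.sqrt_le_iff.2 ⟨norm_nonneg _, hqs _ _⟩)
      (Real.sqrt_le_iff.2 ⟨norm_nonneg _, hqs _ _⟩) (Real.sqrt_nonneg _) (norm_nonneg _)
  have hyy : inner ℂ y y = ∑ n ∈ Finset.range M, ((f n - f (n+1) : ℝ) : ℂ) *
      (inner ℂ y ((P (n+1)).starProjection (B x)) - inner ℂ y (B ((P (n+1)).starProjection x))) := by
    conv_lhs => rw [hy, ← hy]
    conv_lhs => arg 3; rw [hy]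
    rw [hE2, hE2, map_sum, inner_sub_right, inner_sum, inner_sum, ← Finset.sum_sub_distrib]
    refine Finset.sum_congr rfl fun n _ => ?_
    rw [map_smul, inner_smul_right, inner_smul_right]; ring
  have hfin : ‖y‖ * ‖y‖ ≤ (2 * δ * ‖B‖ * ‖x‖) * ‖y‖ := by
    have hn : ‖(inner ℂ y y : ℂ)‖ = ‖y‖ * ‖y‖ := by rw [inner_self_eq_norm_sq_to_K]; simp [pow_two]
    rw [← hn, hyy]
    refine (norm_sum_le _ _).trans ?_
    calc _ ≤ ∑ n ∈ Finset.range M, δ * (‖B‖ * (q (n+0) y * q (n+1) x + q (n+1) y * q (n+0) x)) := by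
          refine Finset.sum_le_sum fun n _ => ?_
          rw [norm_mul]
          refine mul_le_mul ?_ ?_ (norm_nonneg _) hδ
          · rw [Complex.norm_real]; exact hf n
          rw [key]
          refine (norm_sub_le _ _).trans ?_
          have b : ∀ u v : K, ‖(inner ℂ u (B v) : ℂ)‖ ≤ ‖B‖ * (‖u‖ * ‖v‖) := fun u v => by
            refine (norm_inner_le_norm _ _).trans ?_
            have := B.le_opNorm v
            nlinarith [norm_nonneg u]
          rw [mul_add]
          exact add_le_add (b _ _) (b _ _)
      _ = δ * (‖B‖ * (∑ n ∈ Finset.range M, q (n+0) y * q (n+1) x + ∑ n ∈ Finset.range M, q (n+1) y * q (n+0) x)) := by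
          rw [← Finset.mul_sum, ← Finset.mul_sum, Finset.sum_add_distrib]
      _ ≤ δ * (‖B‖ * (‖y‖ * ‖x‖ + ‖y‖ * ‖x‖)) := by
          exact mul_le_mul_of_nonneg_left (mul_le_mul_of_nonneg_left
            (add_le_add (hcs 0 1 y x) (hcs 1 0 y x)) (norm_nonneg _)) hδ
      _ = _ := by ring
  rcases (norm_nonneg y).eq_or_lt with h | h
  · rw [← h]; positivity
  · exact le_of_mul_le_mul_right hfin h
end


section
variable {K : Type*} [NormedAddCommGroup K] [InnerProductSpace ℂ K] [CompleteSpace K]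

theorem hasSum_swap (a : ℕ → ℕ → ℝ) (ha : ∀ k n, 0 ≤ a k n) (u v : ℕ → ℝ) (s : ℝ)
    (h1 : ∀ n, HasSum (fun k => a k n) (u n)) (h2 : ∀ k, HasSum (fun n => a k n) (v k))
    (h3 : HasSum u s) : HasSum v s := by
  have hs : Summable (fun p : ℕ × ℕ => a p.2 p.1) := by
    refine (summable_prod_of_nonneg (fun p => ha _ _)).2 ⟨fun n => (h1 n).summable, ?_⟩
    simp only [(h1 _).tsum_eq]
    exact h3.summable
  have hs1 : HasSum (fun p : ℕ × ℕ => a p.2 p.1) s := by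
    have := hs.hasSum.prod_fiberwise h1
    rw [← this.unique h3]; exact hs.hasSum
  have hs2 : HasSum (fun p : ℕ × ℕ => a p.1 p.2) s := by
    have := (Equiv.prodComm ℕ ℕ).hasSum_iff.2 hs1
    exact this
  exact hs2.prod_fiberwise h2

theorem sum_norm_sq (P : ℕ → Submodule ℂ K) [∀ n, FiniteDimensional ℂ (P n)] (hm : Monotone P)
    (f : ℕ → ℝ) (M : ℕ) (x : K) :
    (∑ n ∈ Finset.range M, ((f n : ℝ) : ℂ) •
      ((P (n+1)).starProjection x - (P n).starProjection x)) ∈ P M ∧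
    ‖∑ n ∈ Finset.range M, ((f n : ℝ) : ℂ) •
      ((P (n+1)).starProjection x - (P n).starProjection x)‖^2 =
    ∑ n ∈ Finset.range M, (f n)^2 * ‖(P (n+1)).starProjection x - (P n).starProjection x‖^2 := by
  induction M with
  | zero => simp
  | succ M ih =>
    rw [Finset.sum_range_succ, Finset.sum_range_succ]
    constructor
    · refine add_mem (hm (Nat.le_succ M) ih.1) (Submodule.smul_mem _ _ (sub_mem ?_ ?_))
      · exact Submodule.starProjection_apply_mem _ _
      · exact hm (Nat.le_succ M) (Submodule.starProjection_apply_mem _ _)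
    · have ho : inner ℂ (∑ n ∈ Finset.range M, ((f n : ℝ) : ℂ) •
          ((P (n+1)).starProjection x - (P n).starProjection x))
          (((f M : ℝ) : ℂ) • ((P (M+1)).starProjection x - (P M).starProjection x)) = 0 := by
        generalize (∑ n ∈ Finset.range M, ((f n : ℝ) : ℂ) •
          ((P (n+1)).starProjection x - (P n).starProjection x)) = z at ih
        rw [inner_smul_right, inner_sub_right, ← Submodule.inner_starProjection_left_eq_right,
          ← Submodule.inner_starProjection_left_eq_right,
          Submodule.starProjection_eq_self_iff.2 ih.1,
          Submodule.starProjection_eq_self_iff.2 (hm (Nat.le_succ M) ih.1)]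
        simp
      have := norm_add_sq_eq_norm_sq_add_norm_sq_of_inner_eq_zero _ _ ho
      rw [pow_two, this, ← pow_two, ih.2, norm_smul, Complex.norm_real, Real.norm_eq_abs]
      congr 1
      rw [← pow_two, mul_pow, sq_abs]

set_option maxHeartbeats 1000000 in
theorem quasi_central [TopologicalSpace.SeparableSpace K] (B : K →L[ℂ] K) (ε : ℝ) (hε : 0 < ε) :
    ∃ (E : ℕ → K →L[ℂ] K) (F : ℕ → Submodule ℂ K), (∀ k, FiniteDimensional ℂ (F k)) ∧
    (∀ k x, E k x ∈ F k) ∧ (∀ k x, B (E k x) ∈ F k) ∧ (∀ k x, adjoint B (E k x) ∈ F k) ∧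
    (∀ x, HasSum (fun k => ‖E k x‖^2) (‖x‖^2)) ∧
    (∀ k x, ‖E k (B x) - B (E k x)‖ ≤ ε * (1/2)^k * ‖x‖) ∧
    (∀ k x, ‖E k (adjoint B x) - adjoint B (E k x)‖ ≤ ε * (1/2)^k * ‖x‖) := by
  obtain ⟨d, hd⟩ := TopologicalSpace.exists_dense_seq K
  obtain ⟨P, P0, PS⟩ : ∃ P : ℕ → Submodule ℂ K, P 0 = ⊥ ∧ ∀ n, P (n+1) = P n ⊔ (P n).map (B : K →ₗ[ℂ] K) ⊔
      (P n).map (adjoint B : K →ₗ[ℂ] K) ⊔ Submodule.span ℂ {d n} :=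
    ⟨fun n => Nat.rec ⊥ (fun n Q => Q ⊔ Q.map (B : K →ₗ[ℂ] K) ⊔
      Q.map (adjoint B : K →ₗ[ℂ] K) ⊔ Submodule.span ℂ {d n}) n, rfl, fun n => rfl⟩
  haveI hfd : ∀ n, FiniteDimensional ℂ (P n) := by
    intro n
    induction n with
    | zero => rw [P0]; infer_instance
    | succ n ih => rw [PS]; infer_instance
  have hm : Monotone P := monotone_nat_of_le_succ fun n => by
    rw [PS]; exact le_sup_of_le_left (le_sup_of_le_left le_sup_left)
  have hB : ∀ n, ∀ x ∈ P n, B x ∈ P (n+1) := fun n x hx => by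
    rw [PS]
    exact (le_sup_of_le_left (le_sup_of_le_left le_sup_right) : (P n).map (B : K →ₗ[ℂ] K) ≤ _)
      (Submodule.mem_map_of_mem hx)
  have hB' : ∀ n, ∀ x ∈ P n, adjoint B x ∈ P (n+1) := fun n x hx => by
    rw [PS]
    exact (le_sup_of_le_left le_sup_right : (P n).map (adjoint B : K →ₗ[ℂ] K) ≤ _)
      (Submodule.mem_map_of_mem hx)
  have htop : ⊤ ≤ (⨆ n, P n).topologicalClosure := by
    intro x _
    have : Set.range d ⊆ ((⨆ n, P n : Submodule ℂ K) : Set K) := by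
      rintro _ ⟨n, rfl⟩
      refine Submodule.mem_iSup_of_mem (n+1) ?_
      rw [PS]
      exact (le_sup_right : Submodule.span ℂ {d n} ≤ _) (Submodule.mem_span_singleton_self _)
    exact closure_mono this (hd x)
  have hlim : ∀ x, Tendsto (fun n => (P n).starProjection x) atTop (𝓝 x) := fun x =>
    Submodule.starProjection_tendsto_self P hm x htop
  obtain ⟨f, hf1, hf2, hf3⟩ := scalar_partition (ε / (2 * (‖B‖ + 1))) (by positivity)
  choose M hM using hf1
  let E : ℕ → K →L[ℂ] K := fun k => ∑ n ∈ Finset.range (M k), ((f k n : ℝ) : ℂ) •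
      ((P (n+1)).starProjection - (P n).starProjection)
  have hE : ∀ k x, E k x = ∑ n ∈ Finset.range (M k), ((f k n : ℝ) : ℂ) •
      ((P (n+1)).starProjection x - (P n).starProjection x) := by
    intro k x; simp [E, ContinuousLinearMap.sum_apply]
  have hEm : ∀ k x, E k x ∈ P (M k) := fun k x => by
    rw [hE]; exact (sum_norm_sq P hm (f k) (M k) x).1
  have hbound : ∀ k, 2 * (ε / (2 * (‖B‖ + 1)) * (1/2)^k) * ‖B‖ ≤ ε * (1/2)^k := by
    intro k
    have : ε / (2 * (‖B‖ + 1)) * (2 * (‖B‖ + 1)) = ε := div_mul_cancel₀ _ (by positivity)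
    set c := ε / (2 * (‖B‖ + 1))
    have hc : 0 < c := by positivity
    rw [← this]
    have : 0 < c * (1/2)^k := by positivity
    nlinarith [norm_nonneg B]
  refine ⟨E, fun k => P (M k + 1), fun k => hfd _, fun k x => hm (Nat.le_succ _) (hEm k x),
    fun k x => hB _ _ (hEm k x), fun k x => hB' _ _ (hEm k x), fun x => ?_, fun k x => ?_, fun k x => ?_⟩
  · refine hasSum_swap (fun k n => (f k n)^2 * ‖(P (n+1)).starProjection x - (P n).starProjection x‖^2)
      (fun k n => by positivity) (fun n => ‖(P (n+1)).starProjection x - (P n).starProjection x‖^2) _ _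
      (fun n => ?_) (fun k => ?_) ?_
    · simpa using (hf3 n).mul_right (‖(P (n+1)).starProjection x - (P n).starProjection x‖^2)
    · rw [hE, (sum_norm_sq P hm (f k) (M k) x).2]
      apply hasSum_sum_of_ne_finset_zero
      intro n hn
      rw [hM k n (by simpa using hn)]; simp
    · rw [hasSum_iff_tendsto_nat_of_nonneg (fun n => by positivity)]
      have h2 : (P 0).starProjection x = 0 := by
        have hz0 : ∀ z ∈ P 0, z = 0 := by rw [P0]; simp
        exact hz0 _ (Submodule.starProjection_apply_mem _ _)
      have h3 : ∀ n, ∑ i ∈ Finset.range n, ‖(P (i+1)).starProjection x - (P i).starProjection x‖^2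
          = ‖(P n).starProjection x‖^2 := by
        intro n
        simp only [pq_sq P hm]
        rw [Finset.sum_range_sub (fun n => ‖(P n).starProjection x‖^2), h2]; simp
      simp only [h3]
      exact ((hlim x).norm).pow 2
  · refine (comm_bound P hm P0 B hB hB' (f k) (M k) (hM k _ le_rfl) _ (hf2 k) (E k) (hE k) x).trans ?_
    exact mul_le_mul_of_nonneg_right (hbound k) (norm_nonneg _)
  · refine (comm_bound P hm P0 (adjoint B) hB' (by simpa using hB) (f k) (M k) (hM k _ le_rfl) _ (hf2 k) (E k) (hE k) x).trans ?_
    rw [LinearIsometryEquiv.norm_map]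
    exact mul_le_mul_of_nonneg_right (hbound k) (norm_nonneg _)
end


section
theorem lp_norm_sq {G : ℕ → Type*} [∀ j, NormedAddCommGroup (G j)] [∀ j, InnerProductSpace ℂ (G j)]
    (x : lp G 2) : HasSum (fun j => ‖x j‖^2) (‖x‖^2) := by
  have := lp.hasSum_norm (p := 2) (by norm_num) x
  simpa using this

theorem lp_build {L : Type*} [NormedAddCommGroup L] [InnerProductSpace ℂ L]
    {G : ℕ → Type*} [∀ j, NormedAddCommGroup (G j)] [∀ j, InnerProductSpace ℂ (G j)]
    (A : ∀ j, L →L[ℂ] G j) (c : ℝ) (s : L → ℝ) (h1 : ∀ x, HasSum (fun j => ‖A j x‖^2) (s x))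
    (h2 : ∀ x, s x ≤ (c * ‖x‖)^2) (hc : 0 ≤ c) : ∃ Φ : L →L[ℂ] lp G 2, ∀ x j, Φ x j = A j x := by
  have hmem : ∀ x, Memℓp (fun j => A j x) 2 := fun x => memℓp_gen (by simpa using (h1 x).summable)
  let Φ : L →ₗ[ℂ] lp G 2 :=
    { toFun := fun x => ⟨fun j => A j x, hmem x⟩
      map_add' := fun x y => by ext j; exact map_add (A j) x y
      map_smul' := fun a x => by ext j; exact map_smul (A j) a x }
  have hΦ : ∀ x j, Φ x j = A j x := fun x j => rfl
  refine ⟨Φ.mkContinuous c fun x => ?_, fun x j => rfl⟩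
  have h3 := lp_norm_sq (Φ x)
  simp only [hΦ] at h3
  have h4 := h3.unique (h1 x)
  have h5 := h2 x
  rw [← h4] at h5
  exact (pow_le_pow_iff_left₀ (norm_nonneg _) (by positivity) (by norm_num)).1 h5

theorem lp_evalb {G : ℕ → Type*} [∀ j, NormedAddCommGroup (G j)] [∀ j, InnerProductSpace ℂ (G j)]
    (i : ℕ) : ∃ e : lp G 2 →L[ℂ] G i, ∀ x, e x = x i := by
  refine ⟨lp.evalCLM ℂ G 2 i, fun x => rfl⟩

end

section
variable {K : Type*} [NormedAddCommGroup K] [InnerProductSpace ℂ K] [CompleteSpace K]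

theorem lp_diag (B : K →L[ℂ] K) :
    ∃ C : lp (fun _ : ℕ => K) 2 →L[ℂ] lp (fun _ : ℕ => K) 2, ∀ x j, C x j = B (x j) := by
  choose e he using fun i => lp_evalb (G := fun _ : ℕ => K) i
  have hb : ∀ (x : lp (fun _ : ℕ => K) 2) j, ‖B (x j)‖^2 ≤ ‖B‖^2 * ‖x j‖^2 := fun x j => by
    rw [← mul_pow]; gcongr; exact B.le_opNorm _
  have hs : ∀ x : lp (fun _ : ℕ => K) 2, Summable (fun j => ‖B (x j)‖^2) := fun x =>
    Summable.of_nonneg_of_le (fun j => by positivity) (hb x) ((lp_norm_sq x).summable.mul_left _)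
  obtain ⟨Φ, hΦ⟩ := lp_build (G := fun _ : ℕ => K) (fun j => B.comp (e j)) ‖B‖
    (fun x => ∑' j, ‖B (x j)‖^2) (fun x => by simpa [he] using (hs x).hasSum)
    (fun x => by
      rw [mul_pow]
      exact hasSum_le (hb x) (hs x).hasSum ((lp_norm_sq x).mul_left _)) (norm_nonneg _)
  exact ⟨Φ, fun x j => by rw [hΦ]; simp [he]⟩

theorem lp_diag_adj (B : K →L[ℂ] K) (C C' : lp (fun _ : ℕ => K) 2 →L[ℂ] lp (fun _ : ℕ => K) 2)
    (hC : ∀ x j, C x j = B (x j)) (hC' : ∀ x j, C' x j = adjoint B (x j)) : adjoint C = C' := by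
  symm
  rw [ContinuousLinearMap.eq_adjoint_iff]
  intro x y
  rw [lp.inner_eq_tsum, lp.inner_eq_tsum]
  simp only [hC, hC', adjoint_inner_left]

/-- shift -/
theorem lp_shift (K : Type*) [NormedAddCommGroup K] [InnerProductSpace ℂ K] : 
    ∃ (S : lp (fun _ : ℕ => K) 2 →L[ℂ] lp (fun _ : ℕ => K) 2)
      (S' : lp (fun _ : ℕ => K) 2 →L[ℂ] lp (fun _ : ℕ => K) 2) (J : K →L[ℂ] lp (fun _ : ℕ => K) 2),
      (∀ x, S x 0 = 0) ∧ (∀ x j, S x (j+1) = x j) ∧ (∀ x j, S' x j = x (j+1)) ∧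
      (∀ x, J x 0 = x) ∧ (∀ x j, J x (j+1) = 0) := by
  choose e he using fun i => lp_evalb (G := fun _ : ℕ => K) i
  obtain ⟨S, hS⟩ := lp_build (G := fun _ : ℕ => K) (fun j => Nat.casesOn j 0 (fun i => e i)) 1
    (fun x => ‖x‖^2) (fun x => by
      rw [← hasSum_nat_add_iff' 1]
      simpa [he] using lp_norm_sq x) (fun x => by simp) zero_le_one
  obtain ⟨S', hS'⟩ := lp_build (G := fun _ : ℕ => K) (fun j => e (j+1)) 1
    (fun x => ‖x‖^2 - ‖x 0‖^2) (fun x => by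
      have := (hasSum_nat_add_iff' 1).2 (lp_norm_sq x)
      simpa [he] using this) (fun x => by simp) zero_le_one
  obtain ⟨J, hJ⟩ := lp_build (L := K) (G := fun _ : ℕ => K) (fun j => Nat.casesOn j (ContinuousLinearMap.id ℂ K) (fun i => 0)) 1
    (fun x => ‖x‖^2) (fun x => by
      rw [← hasSum_nat_add_iff' 1]
      simpa [he] using hasSum_zero) (fun x => by simp) zero_le_one
  refine ⟨S, S', J, fun x => ?_, fun x j => ?_, fun x j => ?_, fun x => ?_, fun x j => ?_⟩
  · rw [hS]; rfl
  · rw [hS]; exact he _ _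
  · rw [hS']; exact he _ _
  · rw [hJ]; rfl
  · rw [hJ]; rfl

theorem hasSum_pair (a : ℕ → ℕ → ℝ) (ha : ∀ k n, 0 ≤ a k n) (u : ℕ → ℝ) (s : ℝ)
    (h1 : ∀ i, HasSum (a i) (u i)) (h3 : HasSum u s) :
    HasSum (fun j : ℕ => a j.unpair.1 j.unpair.2) s := by
  have hs : Summable (fun p : ℕ × ℕ => a p.1 p.2) := by
    refine (summable_prod_of_nonneg (fun p => ha _ _)).2 ⟨fun n => (h1 n).summable, ?_⟩
    simp only [(h1 _).tsum_eq]
    exact h3.summable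
  have hs1 : HasSum (fun p : ℕ × ℕ => a p.1 p.2) s := by
    have := hs.hasSum.prod_fiberwise h1
    rw [← this.unique h3]; exact hs.hasSum
  have h := Nat.pairEquiv.symm.hasSum_iff.2 hs1
  have e : (fun p : ℕ × ℕ => a p.1 p.2) ∘ Nat.pairEquiv.symm =
      (fun j : ℕ => a j.unpair.1 j.unpair.2) := by
    funext j
    simp only [Function.comp_apply, Nat.pairEquiv_symm_apply]
  rw [e] at h
  exact h

theorem lp_part [TopologicalSpace.SeparableSpace K] (B : K →L[ℂ] K) (ε : ℝ) (hε : 0 < ε)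
    (C C' : lp (fun _ : ℕ => K) 2 →L[ℂ] lp (fun _ : ℕ => K) 2)
    (hC : ∀ x j, C x j = B (x j)) (hC' : ∀ x j, C' x j = adjoint B (x j)) :
    ∃ (E : ℕ → lp (fun _ : ℕ => K) 2 →L[ℂ] K) (F : ℕ → Submodule ℂ K) (w : ℕ → ℝ),
    HasSum w (4 * ε) ∧ (∀ k, FiniteDimensional ℂ (F k)) ∧
    (∀ k x, E k x ∈ F k) ∧ (∀ k x, B (E k x) ∈ F k) ∧ (∀ k x, adjoint B (E k x) ∈ F k) ∧
    (∀ x, HasSum (fun k => ‖E k x‖^2) (‖x‖^2)) ∧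
    (∀ k x, ‖E k (C x) - B (E k x)‖ ≤ w k * ‖x‖) ∧
    (∀ k x, ‖E k (C' x) - adjoint B (E k x)‖ ≤ w k * ‖x‖) := by
  choose e he using fun i => lp_evalb (G := fun _ : ℕ => K) i
  choose E F h1 h2 h3 h4 h5 h6 h7 using fun i : ℕ => quasi_central B (ε * (1/2)^i) (by positivity)
  have hei : ∀ (x : lp (fun _ : ℕ => K) 2) i, ‖x i‖ ≤ ‖x‖ := fun x i => lp.norm_apply_le_norm (by norm_num) x i
  refine ⟨fun j => (E j.unpair.1 j.unpair.2).comp (e j.unpair.1), fun j => F j.unpair.1 j.unpair.2,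
    fun j => ε * (1/2)^j.unpair.1 * (1/2)^j.unpair.2, ?_, fun j => h1 _ _, fun j x => h2 _ _ _,
    fun j x => h3 _ _ _, fun j x => h4 _ _ _, fun x => ?_, fun j x => ?_, fun j x => ?_⟩
  · refine hasSum_pair (fun i k => ε * (1/2)^i * (1/2)^k) (fun i k => by positivity)
      (fun i => ε * (1/2)^i * 2) _ (fun i => hasSum_geometric_two.mul_left _) ?_
    have := (hasSum_geometric_two.mul_left ε).mul_right 2
    have e4 : ε * 2 * 2 = 4 * ε := by ring
    rw [← e4]; exact this
  · have := hasSum_pair (fun i k => ‖E i k (x i)‖^2) (fun i k => by positivity)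
      (fun i => ‖x i‖^2) _ (fun i => h5 i (x i)) (lp_norm_sq x)
    simpa only [ContinuousLinearMap.comp_apply, he] using this
  · simp only [ContinuousLinearMap.comp_apply, he, hC]
    refine (h6 _ _ _).trans ?_
    gcongr; exact hei _ _
  · simp only [ContinuousLinearMap.comp_apply, he, hC']
    refine (h7 _ _ _).trans ?_
    gcongr; exact hei _ _
end


section
variable {H K ι : Type*} [NormedAddCommGroup H] [InnerProductSpace ℂ H] [CompleteSpace H]
  [NormedAddCommGroup K] [InnerProductSpace ℂ K] [CompleteSpace K]

theorem seq_step (T : H →L[ℂ] H) (B : K →L[ℂ] K) (l : Filter ι) [NeBot l]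
    (Z : ι → K →ₗᵢ[ℂ] H) (hw : ∀ x y, Tendsto (fun i => inner ℂ y (Z i x)) l (𝓝 0))
    (h1 : ∀ x, Tendsto (fun i => T (Z i x) - Z i (B x)) l (𝓝 0))
    (h2 : ∀ x, Tendsto (fun i => adjoint T (Z i x) - Z i (adjoint B x)) l (𝓝 0))
    (F : ℕ → Submodule ℂ K) (hF : ∀ j, FiniteDimensional ℂ (F j)) (η : ℕ → ℝ) (hη : ∀ j, 0 < η j) :
    ∃ Y : ∀ j, F j →ₗᵢ[ℂ] H, OrthogonalFamily ℂ (fun j => F j) Y ∧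
      (∀ j (x y : F j), (y:K) = B x → ‖T (Y j x) - Y j y‖ ≤ η j * ‖x‖) ∧
      (∀ j (x y : F j), (y:K) = adjoint B x → ‖adjoint T (Y j x) - Y j y‖ ≤ η j * ‖x‖) := by
  have hst : ∀ (j : ℕ) (N : {N : Submodule ℂ H // FiniteDimensional ℂ N}),
      ∃ Y : F j →ₗᵢ[ℂ] H, (∀ x, Y x ∈ N.1ᗮ) ∧
      (∀ x y : F j, (y:K) = B x → ‖T (Y x) - Y y‖ ≤ η j * ‖x‖) ∧
      (∀ x y : F j, (y:K) = adjoint B x → ‖adjoint T (Y x) - Y y‖ ≤ η j * ‖x‖) := by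
    intro j N
    have := hF j
    have := N.2
    exact step T B l Z hw h1 h2 (F j) N.1 (η j) (hη j)
  choose G hG1 hG2 hG3 using hst
  obtain ⟨N, hN⟩ : ∃ N : ℕ → {N : Submodule ℂ H // FiniteDimensional ℂ N},
      ∀ j, (N (j+1)).1 = (N j).1 ⊔ LinearMap.range (G j (N j)).toLinearMap := by
    have hfd : ∀ (j : ℕ) (M : {N : Submodule ℂ H // FiniteDimensional ℂ N}),
        FiniteDimensional ℂ (M.1 ⊔ LinearMap.range (G j M).toLinearMap : Submodule ℂ H) := by
      intro j M
      have := hF j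
      have := M.2
      infer_instance
    exact ⟨fun n => Nat.rec ⟨⊥, inferInstance⟩ (fun j M => ⟨M.1 ⊔ LinearMap.range (G j M).toLinearMap, hfd j M⟩) n, fun j => rfl⟩
  have hmono : Monotone (fun j => (N j).1) := monotone_nat_of_le_succ fun n => by
    rw [hN]; exact le_sup_left
  have hlt : ∀ i j, i < j → ∀ (x : F i) (y : F j), inner ℂ (G i (N i) x) (G j (N j) y) = 0 := by
    intro i j hij x y
    have a : G i (N i) x ∈ (N j).1 := by
      apply hmono (Nat.succ_le_of_lt hij)
      show _ ∈ (N (i+1)).1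
      rw [hN]
      exact (le_sup_right : LinearMap.range (G i (N i)).toLinearMap ≤ _) ⟨x, rfl⟩
    exact (Submodule.mem_orthogonal _ _).1 (hG1 j (N j) y) _ a
  refine ⟨fun j => G j (N j), ?_, fun j => hG2 j _, fun j => hG3 j _⟩
  intro i j hij x y
  rcases lt_or_gt_of_ne hij with h | h
  · exact hlt i j h x y
  · exact inner_eq_zero_symm.1 (hlt j i h y x)

theorem build_bound (T : H →L[ℂ] H) {L : Type*} [NormedAddCommGroup L] [InnerProductSpace ℂ L]
    (B : K →L[ℂ] K) (C : L →L[ℂ] L) (E : ℕ → L →L[ℂ] K) (F : ℕ → Submodule ℂ K) 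
    (w η : ℕ → ℝ) (a b : ℝ) (hw : HasSum w a) (hη : HasSum η b) (hη0 : ∀ j, 0 ≤ η j)
    (hE : ∀ k x, E k x ∈ F k) (hE1 : ∀ k x, B (E k x) ∈ F k)
    (hEn : ∀ k x, ‖E k x‖ ≤ ‖x‖) 
    (hE2 : ∀ k x, ‖E k (C x) - B (E k x)‖ ≤ w k * ‖x‖)
    (Y : ∀ j, F j →ₗᵢ[ℂ] H) (hY : ∀ j (x y : F j), (y:K) = B x → ‖T (Y j x) - Y j y‖ ≤ η j * ‖x‖)
    (V : L →ₗᵢ[ℂ] H) (hV : ∀ x, HasSum (fun j => Y j ⟨E j x, hE j x⟩) (V x)) (x : L) :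
    ‖T (V x) - V (C x)‖ ≤ (b + a) * ‖x‖ := by
  have h1 : HasSum (fun j => T (Y j ⟨E j x, hE j x⟩) - Y j ⟨E j (C x), hE j (C x)⟩) (T (V x) - V (C x)) :=
    ((hV x).mapL T).sub (hV (C x))
  have h2 : HasSum (fun j => (η j + w j) * ‖x‖) ((b + a) * ‖x‖) := (hη.add hw).mul_right _
  rw [← h1.tsum_eq]
  refine tsum_of_norm_bounded h2 fun j => ?_
  have e : T (Y j ⟨E j x, hE j x⟩) - Y j ⟨E j (C x), hE j (C x)⟩ =
    (T (Y j ⟨E j x, hE j x⟩) - Y j ⟨B (E j x), hE1 j x⟩) -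
      Y j (⟨E j (C x), hE j (C x)⟩ - ⟨B (E j x), hE1 j x⟩) := by
    rw [map_sub]; abel
  rw [e, add_mul]
  refine (norm_sub_le _ _).trans (add_le_add ?_ ?_)
  · refine (hY j _ _ rfl).trans ?_
    exact mul_le_mul_of_nonneg_left (hEn j x) (hη0 j)
  · rw [LinearIsometry.norm_map]
    exact hE2 j x

theorem build_V [TopologicalSpace.SeparableSpace K]
    (T : H →L[ℂ] H) (B : K →L[ℂ] K) (l : Filter ι) [NeBot l]
    (Z : ι → K →ₗᵢ[ℂ] H) (hw : ∀ x y, Tendsto (fun i => inner ℂ y (Z i x)) l (𝓝 0))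
    (h1 : ∀ x, Tendsto (fun i => T (Z i x) - Z i (B x)) l (𝓝 0))
    (h2 : ∀ x, Tendsto (fun i => adjoint T (Z i x) - Z i (adjoint B x)) l (𝓝 0))
    (ε : ℝ) (hε : 0 < ε)
    (C C' : lp (fun _ : ℕ => K) 2 →L[ℂ] lp (fun _ : ℕ => K) 2)
    (hC : ∀ x j, C x j = B (x j)) (hC' : ∀ x j, C' x j = adjoint B (x j)) :
    ∃ V : lp (fun _ : ℕ => K) 2 →ₗᵢ[ℂ] H, (∀ x, ‖T (V x) - V (C x)‖ ≤ 6 * ε * ‖x‖) ∧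
      (∀ x, ‖adjoint T (V x) - V (C' x)‖ ≤ 6 * ε * ‖x‖) := by
  obtain ⟨E, F, w, k1, k2, k3, k4, k5, k6, k7, k8⟩ := lp_part B ε hε C C' hC hC'
  have hη0 : ∀ j : ℕ, 0 < ε * (1/2 : ℝ)^j := fun j => by positivity
  have hη : HasSum (fun j : ℕ => ε * (1/2 : ℝ)^j) (ε * 2) := hasSum_geometric_two.mul_left ε
  obtain ⟨Y, hY, hY1, hY2⟩ := seq_step T B l Z hw h1 h2 F k2 _ hη0
  have hEn : ∀ k x, ‖E k x‖ ≤ ‖x‖ := fun k x => by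
    have := le_hasSum (k6 x) k (fun j _ => by positivity)
    exact (pow_le_pow_iff_left₀ (norm_nonneg _) (norm_nonneg _) (by norm_num)).1 this
  obtain ⟨Φ, hΦ⟩ := lp_build (G := fun j => F j) (fun j => (E j).codRestrict (F j) (k3 j)) 1
    (fun x => ‖x‖^2) (fun x => k6 x) (fun x => by simp) zero_le_one
  have hΦn : ∀ x, ‖Φ x‖ = ‖x‖ := fun x => by
    have a := lp_norm_sq (Φ x)
    simp only [hΦ] at a
    have := a.unique (k6 x)
    exact (pow_left_inj₀ (norm_nonneg _) (norm_nonneg _) (by norm_num)).1 this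
  let Φ' : lp (fun _ : ℕ => K) 2 →ₗᵢ[ℂ] lp (fun j => F j) 2 := ⟨Φ.toLinearMap, hΦn⟩
  have : ∀ j, FiniteDimensional ℂ (F j) := k2
  let V := hY.linearIsometry.comp Φ'
  have hV : ∀ x, HasSum (fun j => Y j ⟨E j x, k3 j x⟩) (V x) := fun x => by
    have := hY.hasSum_linearIsometry (Φ x)
    simp only [hΦ] at this
    exact this
  have e6 : ε * 2 + 4 * ε = 6 * ε := by ring
  refine ⟨V, fun x => ?_, fun x => ?_⟩
  · rw [← e6]
    exact build_bound T B C E F w _ _ _ k1 hη (fun j => (hη0 j).le) k3 k4 hEn k7 Y hY1 V hV x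
  · rw [← e6]
    exact build_bound (adjoint T) (adjoint B) C' E F w _ _ _ k1 hη (fun j => (hη0 j).le) k3 k5 hEn k8 Y hY2 V hV x
end


section
variable {H K L : Type*} [NormedAddCommGroup H] [InnerProductSpace ℂ H] [CompleteSpace H]
  [NormedAddCommGroup K] [InnerProductSpace ℂ K] [CompleteSpace K]
  [NormedAddCommGroup L] [InnerProductSpace ℂ L] [CompleteSpace L]

/-- direct sum of operators -/
noncomputable def dsum {H K : Type*} [NormedAddCommGroup H] [InnerProductSpace ℂ H]
    [NormedAddCommGroup K] [InnerProductSpace ℂ K] (T : H →L[ℂ] H) (B : K →L[ℂ] K) :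
    WithLp 2 (H × K) →L[ℂ] WithLp 2 (H × K) :=
  ((WithLp.prodContinuousLinearEquiv 2 ℂ H K).symm : H × K →L[ℂ] WithLp 2 (H × K)).comp
    ((T.prodMap B).comp ((WithLp.prodContinuousLinearEquiv 2 ℂ H K) : WithLp 2 (H × K) →L[ℂ] H × K))

theorem dsum_fst (T : H →L[ℂ] H) (B : K →L[ℂ] K) (w) : (dsum T B w).fst = T w.fst := rfl
theorem dsum_snd (T : H →L[ℂ] H) (B : K →L[ℂ] K) (w) : (dsum T B w).snd = B w.snd := rfl

theorem dsum_adjoint (T : H →L[ℂ] H) (B : K →L[ℂ] K) :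
    adjoint (dsum T B) = dsum (adjoint T) (adjoint B) := by
  symm
  rw [ContinuousLinearMap.eq_adjoint_iff]
  intro x y
  simp only [WithLp.prod_inner_apply]
  show inner ℂ (adjoint T x.fst) y.fst + inner ℂ (adjoint B x.snd) y.snd =
    inner ℂ x.fst (T y.fst) + inner ℂ x.snd (B y.snd)
  rw [adjoint_inner_left, adjoint_inner_left]

set_option maxHeartbeats 1000000 in
theorem absorb (T : H →L[ℂ] H) (B : K →L[ℂ] K) (C C' : L →L[ℂ] L) (hCC : adjoint C = C')
    (V : L →ₗᵢ[ℂ] H) (S : L →L[ℂ] L) (S' : L →L[ℂ] L) (J : K →L[ℂ] L) (J' : L → K)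
    (hn : ∀ x k, ‖S x + J k‖^2 = ‖x‖^2 + ‖k‖^2) (hsurj : ∀ x, S (S' x) + J (J' x) = x)
    (hCS : ∀ x, C (S x) = S (C x)) (hCJ : ∀ k, C (J k) = J (B k))
    (ε : ℝ) (hV1 : ∀ x, ‖T (V x) - V (C x)‖ ≤ ε * ‖x‖)
    (hV2 : ∀ x, ‖adjoint T (V x) - V (C' x)‖ ≤ ε * ‖x‖) (hε : 0 ≤ ε) :
    ∃ U : WithLp 2 (H × K) ≃ₗᵢ[ℂ] H, ∀ w, ‖U (dsum T B w) - T (U w)‖ ≤ 5 * ε * ‖w‖ := by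
  let v : L →L[ℂ] H := V.toContinuousLinearMap
  let v' : H →L[ℂ] L := adjoint v
  have hv : ∀ x, v x = V x := fun x => rfl
  have hvn : ∀ x, ‖v x‖ = ‖x‖ := fun x => V.norm_map x
  have hvv : ∀ x, v' (v x) = x := fun x => by
    refine ext_inner_left ℂ fun y => ?_
    rw [adjoint_inner_right]
    exact V.inner_map_map y x
  have hv'n : ∀ x, ‖v' x‖ ≤ ‖x‖ := fun x => by
    have h1 : ‖v'‖ = ‖v‖ := LinearIsometryEquiv.norm_map _ _
    have h2 : ‖v‖ ≤ 1 := V.norm_toContinuousLinearMap_le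
    calc ‖v' x‖ ≤ ‖v'‖ * ‖x‖ := v'.le_opNorm x
      _ ≤ 1 * ‖x‖ := by gcongr; rw [h1]; exact h2
      _ = ‖x‖ := one_mul _
  have hSn : ∀ x, ‖S x‖ = ‖x‖ := fun x => by
    have := hn x 0
    simp only [map_zero, add_zero, norm_zero] at this
    exact (pow_left_inj₀ (norm_nonneg _) (norm_nonneg _) (by norm_num : (2:ℕ) ≠ 0)).1 (by rw [this]; simp)
  have hJn : ∀ x, ‖J x‖ = ‖x‖ := fun x => by
    have := hn 0 x
    simp only [map_zero, zero_add, norm_zero] at this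
    exact (pow_left_inj₀ (norm_nonneg _) (norm_nonneg _) (by norm_num : (2:ℕ) ≠ 0)).1 (by rw [this]; simp)
  have hV2' : ∀ h, ‖v' (T h) - C (v' h)‖ ≤ ε * ‖h‖ := by
    have e : adjoint (adjoint T ∘L v - v ∘L C') = v' ∘L T - C ∘L v' := by
      rw [map_sub, adjoint_comp, adjoint_comp, ← hCC, adjoint_adjoint, adjoint_adjoint]
    have h1 : ‖adjoint T ∘L v - v ∘L C'‖ ≤ ε := ContinuousLinearMap.opNorm_le_bound _ hε hV2
    have h2 : ‖v' ∘L T - C ∘L v'‖ ≤ ε := by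
      rw [← e, LinearIsometryEquiv.norm_map]; exact h1
    exact fun h => ContinuousLinearMap.le_of_opNorm_le _ h2 h
  let U0 : WithLp 2 (H × K) →ₗ[ℂ] H :=
    { toFun := fun w => (w.fst - v (v' w.fst)) + v (S (v' w.fst) + J w.snd)
      map_add' := fun x y => by
        simp only [WithLp.add_fst, WithLp.add_snd, map_add]; abel
      map_smul' := fun c x => by
        simp only [WithLp.smul_fst, WithLp.smul_snd, map_smul, RingHom.id_apply, map_add, smul_add, smul_sub] }
  have hU0 : ∀ w, U0 w = (w.fst - v (v' w.fst)) + v (S (v' w.fst) + J w.snd) := fun w => rfl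
  have horth : ∀ h l, inner ℂ (h - v (v' h)) (v l) = 0 := fun h l => by
    rw [← adjoint_inner_left, map_sub]
    show inner ℂ (v' h - v' (v (v' h))) l = 0
    rw [hvv]; simp
  have hiso : ∀ w, ‖U0 w‖ = ‖w‖ := fun w => by
    have h1 : ‖U0 w‖^2 = ‖w.fst - v (v' w.fst)‖^2 + (‖v' w.fst‖^2 + ‖w.snd‖^2) := by
      rw [hU0, pow_two, norm_add_sq_eq_norm_sq_add_norm_sq_of_inner_eq_zero _ _ (horth _ _),
        hvn, ← pow_two, ← pow_two, hn]
    have h2 : ‖w.fst‖^2 = ‖w.fst - v (v' w.fst)‖^2 + ‖v' w.fst‖^2 := by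
      conv_lhs => rw [← sub_add_cancel w.fst (v (v' w.fst)), pow_two, norm_add_sq_eq_norm_sq_add_norm_sq_of_inner_eq_zero _ _ (horth _ _),
        hvn, ← pow_two, ← pow_two]
    have h3 := WithLp.prod_norm_sq_eq_of_L2 w
    exact (pow_left_inj₀ (norm_nonneg _) (norm_nonneg _) (by norm_num : (2:ℕ) ≠ 0)).1 (by rw [h1, h3, h2]; ring)
  let U1 : WithLp 2 (H × K) →ₗᵢ[ℂ] H := ⟨U0, hiso⟩
  have hsj : Function.Surjective U1 := fun g => by
    refine ⟨WithLp.toLp 2 ((g - v (v' g)) + v (S' (v' g)), J' (v' g)), ?_⟩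
    show ((g - v (v' g)) + v (S' (v' g)) - v (v' ((g - v (v' g)) + v (S' (v' g))))) + 
      v (S (v' ((g - v (v' g)) + v (S' (v' g)))) + J (J' (v' g))) = g
    have : v' ((g - v (v' g)) + v (S' (v' g))) = S' (v' g) := by
      rw [map_add, map_sub, hvv, hvv]; simp
    rw [this, hsurj]; abel
  refine ⟨LinearIsometryEquiv.ofSurjective U1 hsj, fun w => ?_⟩
  show ‖U0 (dsum T B w) - T (U0 w)‖ ≤ _
  rw [hU0, hU0, dsum_fst, dsum_snd]
  have hf : ‖w.fst‖ ≤ ‖w‖ := by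
    have h3 := WithLp.prod_norm_sq_eq_of_L2 w
    exact (pow_le_pow_iff_left₀ (norm_nonneg _) (norm_nonneg _) (by norm_num : (2:ℕ) ≠ 0)).1 (by rw [h3]; nlinarith [sq_nonneg ‖w.snd‖])
  have hs : ‖w.snd‖ ≤ ‖w‖ := by
    have h3 := WithLp.prod_norm_sq_eq_of_L2 w
    exact (pow_le_pow_iff_left₀ (norm_nonneg _) (norm_nonneg _) (by norm_num : (2:ℕ) ≠ 0)).1 (by rw [h3]; nlinarith [sq_nonneg ‖w.fst‖])
  generalize w.fst = h at *
  generalize w.snd = k at *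
  have e : (T h - v (v' (T h))) + v (S (v' (T h)) + J (B k)) - T ((h - v (v' h)) + v (S (v' h) + J k)) =
      (T (v (v' h)) - v (C (v' h))) - v (v' (T h) - C (v' h)) + v (S (v' (T h) - C (v' h)))
      - (T (v (S (v' h))) - v (C (S (v' h)))) - (T (v (J k)) - v (C (J k))) := by
    rw [hCS, hCJ]
    simp only [map_sub, map_add]; abel
  rw [e]
  have b1 : ‖T (v (v' h)) - v (C (v' h))‖ ≤ ε * ‖w‖ := (hV1 _).trans (by gcongr; exact (hv'n _).trans hf)
  have b2 : ‖v (v' (T h) - C (v' h))‖ ≤ ε * ‖w‖ := by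
    rw [hvn]; exact (hV2' h).trans (by gcongr)
  have b3 : ‖v (S (v' (T h) - C (v' h)))‖ ≤ ε * ‖w‖ := by
    rw [hvn, hSn]; exact (hV2' h).trans (by gcongr)
  have b4 : ‖T (v (S (v' h))) - v (C (S (v' h)))‖ ≤ ε * ‖w‖ := (hV1 _).trans (by
    rw [hSn]; gcongr; exact (hv'n _).trans hf)
  have b5 : ‖T (v (J k)) - v (C (J k))‖ ≤ ε * ‖w‖ := (hV1 _).trans (by
    rw [hJn]; gcongr)
  refine (norm_sub_le _ _).trans ?_
  have c1 := norm_sub_le ((T (v (v' h)) - v (C (v' h))) - v (v' (T h) - C (v' h)) + v (S (v' (T h) - C (v' h)))) (T (v (S (v' h))) - v (C (S (v' h))))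
  have c2 := norm_add_le ((T (v (v' h)) - v (C (v' h))) - v (v' (T h) - C (v' h))) (v (S (v' (T h) - C (v' h))))
  have c3 := norm_sub_le (T (v (v' h)) - v (C (v' h))) (v (v' (T h) - C (v' h)))
  linarith

end


section
variable {H K ι : Type*} [NormedAddCommGroup H] [InnerProductSpace ℂ H] [CompleteSpace H]
  [NormedAddCommGroup K] [InnerProductSpace ℂ K] [CompleteSpace K]

theorem key_absorb [TopologicalSpace.SeparableSpace K]
    (T : H →L[ℂ] H) (B : K →L[ℂ] K) (l : Filter ι) [NeBot l]
    (Z : ι → K →ₗᵢ[ℂ] H) (hw : ∀ x y, Tendsto (fun i => inner ℂ y (Z i x)) l (𝓝 0))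
    (h1 : ∀ x, Tendsto (fun i => T (Z i x) - Z i (B x)) l (𝓝 0))
    (h2 : ∀ x, Tendsto (fun i => adjoint T (Z i x) - Z i (adjoint B x)) l (𝓝 0))
    (ε : ℝ) (hε : 0 < ε) :
    ∃ U : WithLp 2 (H × K) ≃ₗᵢ[ℂ] H, ‖conjOp U (dsum T B) - T‖ ≤ ε := by
  obtain ⟨C, hC⟩ := lp_diag B
  obtain ⟨C', hC'⟩ := lp_diag (adjoint B)
  obtain ⟨V, hV1, hV2⟩ := build_V T B l Z hw h1 h2 (ε/30) (by positivity) C C' hC hC'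
  obtain ⟨S, S', J, hS0, hS1, hS', hJ0, hJ1⟩ := lp_shift K
  obtain ⟨U, hU⟩ := absorb T B C C' (lp_diag_adj B C C' hC hC') V S S' J (fun x => x 0)
    (fun x k => by
      have a := lp_norm_sq (S x + J k)
      rw [← hasSum_nat_add_iff' 1] at a
      have e : ∀ j, (S x + J k) (j+1) = x j := fun j => by
        rw [lp.coeFn_add, Pi.add_apply, hS1, hJ1, add_zero]
      have e0 : (S x + J k) 0 = k := by
        rw [lp.coeFn_add, Pi.add_apply, hS0, hJ0, zero_add]
      simp only [e, Finset.sum_range_one, e0] at a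
      have := a.unique (lp_norm_sq x)
      linarith)
    (fun x => by
      ext j
      rw [lp.coeFn_add, Pi.add_apply]
      cases j with
      | zero => rw [hS0, hJ0, zero_add]
      | succ j => rw [hS1, hJ1, hS', add_zero])
    (fun x => by
      ext j
      rw [hC]
      cases j with
      | zero => rw [hS0, hS0, map_zero]
      | succ j => rw [hS1, hS1, hC])
    (fun x => by
      ext j
      rw [hC]
      cases j with
      | zero => rw [hJ0, hJ0]
      | succ j => rw [hJ1, hJ1, map_zero])
    (6 * (ε/30)) hV1 hV2 (by positivity)
  refine ⟨U, ContinuousLinearMap.opNorm_le_bound _ hε.le fun x => ?_⟩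
  have := hU (U.symm x)
  rw [LinearIsometryEquiv.apply_symm_apply, LinearIsometryEquiv.norm_map] at this
  show ‖U (dsum T B (U.symm x)) - T x‖ ≤ ε * ‖x‖
  calc _ ≤ _ := this
    _ = ε * ‖x‖ := by ring
end


section
variable {H ι : Type*} [NormedAddCommGroup H] [InnerProductSpace ℂ H] [CompleteSpace H]

theorem weak_lim (u : Ultrafilter ι) (Z : ι → H →ₗᵢ[ℂ] H) :
    ∃ V : H →L[ℂ] H, ∀ x y, Tendsto (fun i => inner ℂ y (Z i x)) u (𝓝 (inner ℂ y (V x))) := by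
  have hlim : ∀ x y, ∃ c : ℂ, ‖c‖ ≤ ‖x‖ * ‖y‖ ∧ Tendsto (fun i => inner ℂ (Z i x) y) u (𝓝 c) := by
    intro x y
    have hcomp := isCompact_closedBall (0 : ℂ) (‖x‖ * ‖y‖)
    obtain ⟨c, hc, h⟩ := hcomp.ultrafilter_le_nhds (u.map (fun i => inner ℂ (Z i x) y)) (by
      rw [Filter.le_principal_iff]
      refine Filter.mem_map.2 (Filter.univ_mem' fun i => ?_)
      show inner ℂ (Z i x) y ∈ Metric.closedBall (0:ℂ) _
      rw [mem_closedBall_zero_iff]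
      refine (norm_inner_le_norm _ _).trans ?_
      rw [LinearIsometry.norm_map])
    exact ⟨c, mem_closedBall_zero_iff.1 hc, h⟩
  choose c hc1 hc2 using hlim
  have hφ : ∀ x, ∃ v : H, ∀ y, inner ℂ v y = c x y := by
    intro x
    let φ : H →ₗ[ℂ] ℂ :=
      { toFun := c x
        map_add' := fun y z => tendsto_nhds_unique (hc2 x (y+z)) (by
          simpa only [inner_add_right] using (hc2 x y).add (hc2 x z))
        map_smul' := fun a y => tendsto_nhds_unique (hc2 x (a • y)) (by
          simpa only [inner_smul_right, smul_eq_mul, RingHom.id_apply] using (hc2 x y).const_mul a) }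
    refine ⟨(InnerProductSpace.toDual ℂ H).symm (φ.mkContinuous ‖x‖ (hc1 x)), fun y => ?_⟩
    rw [InnerProductSpace.toDual_symm_apply]; rfl
  choose v hv using hφ
  have hv2 : ∀ x y, Tendsto (fun i => inner ℂ (Z i x) y) u (𝓝 (inner ℂ (v x) y)) := fun x y => by
    rw [hv]; exact hc2 x y
  have hvn : ∀ x, ‖v x‖ ≤ 1 * ‖x‖ := fun x => by
    have h := hc1 x (v x)
    rw [← hv] at h
    have hn : ‖(inner ℂ (v x) (v x) : ℂ)‖ = ‖v x‖ * ‖v x‖ := by rw [inner_self_eq_norm_sq_to_K]; simp [pow_two]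
    rw [hn] at h
    rcases (norm_nonneg (v x)).eq_or_lt with h0 | h0
    · rw [← h0]; positivity
    · rw [one_mul]; exact le_of_mul_le_mul_right h h0
  let V : H →ₗ[ℂ] H :=
    { toFun := v
      map_add' := fun x y => ext_inner_right ℂ fun z => tendsto_nhds_unique (hv2 (x+y) z) (by
        simpa only [map_add, inner_add_left] using (hv2 x z).add (hv2 y z))
      map_smul' := fun a x => ext_inner_right ℂ fun z => tendsto_nhds_unique (hv2 (a • x) z) (by
        simpa only [map_smul, inner_smul_left, RingHom.id_apply] using (hv2 x z).const_mul _) }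
  refine ⟨V.mkContinuous 1 hvn, fun x y => ?_⟩
  have := (Complex.continuous_conj.tendsto _).comp (hv2 x y)
  simp only [Function.comp_def, inner_conj_symm] at this
  exact this

theorem abs_comm (V B : H →L[ℂ] H) (h : Commute (star V * V) B) :
    Commute (CFC.abs V) B := by
  have hs : IsSelfAdjoint (star V * V) := IsSelfAdjoint.star_mul_self V
  unfold CFC.abs CFC.sqrt
  exact Commute.cfcₙ_nnreal h _

theorem cfcabs_norm (V : H →L[ℂ] H) (x : H) : ‖CFC.abs V x‖ = ‖V x‖ := by
  have h1 := CFC.abs_mul_abs V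
  have h2 : IsSelfAdjoint (CFC.abs V) := (CFC.abs_nonneg V).isSelfAdjoint
  have h3 : inner ℂ (CFC.abs V x) (CFC.abs V x) = inner ℂ (V x) (V x) := by
    rw [← adjoint_inner_left, ← adjoint_inner_left, ← star_eq_adjoint, ← star_eq_adjoint, h2.star_eq]
    show inner ℂ ((CFC.abs V * CFC.abs V) x) x = inner ℂ ((star V * V) x) x
    rw [h1]
  rw [inner_self_eq_norm_sq_to_K, inner_self_eq_norm_sq_to_K] at h3
  have h4 : ‖CFC.abs V x‖^2 = ‖V x‖^2 := by exact_mod_cast h3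
  exact (pow_left_inj₀ (norm_nonneg _) (norm_nonneg _) (by norm_num : (2:ℕ) ≠ 0)).1 h4

theorem polar_ex (V : H →L[ℂ] H) (K : Submodule ℂ H) [CompleteSpace K] (hK : ∀ x, x ∈ K ↔ V x = 0) :
    ∃ Y : H →L[ℂ] H, (∀ x, Y (CFC.abs V x) = V x) ∧ (∀ x ∈ K, Y x = 0) ∧
      (∀ x ∈ Kᗮ, ‖Y x‖ = ‖x‖) ∧ (∀ x ∈ Kᗮ, x ∈ closure (Set.range (fun z => CFC.abs V z))) := by
  have h2 : IsSelfAdjoint (CFC.abs V) := (CFC.abs_nonneg V).isSelfAdjoint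
  have hadj : ∀ x y, inner ℂ (CFC.abs V x) y = inner ℂ x (CFC.abs V y) := fun x y => by
    rw [← adjoint_inner_right, ← star_eq_adjoint, h2.star_eq]
  have habs0 : ∀ x, CFC.abs V x = 0 ↔ x ∈ K := fun x => by
    rw [hK, ← norm_eq_zero, cfcabs_norm, norm_eq_zero]
  have hmem : ∀ x, CFC.abs V x ∈ Kᗮ := fun x => by
    rw [Submodule.mem_orthogonal']
    intro u hu
    rw [hadj, (habs0 u).2 hu, inner_zero_right]
  have hcl : ∀ x ∈ Kᗮ, x ∈ closure (Set.range (fun z => CFC.abs V z)) := by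
    intro x hx
    have h3 : (LinearMap.range ((CFC.abs V : H →L[ℂ] H) : H →ₗ[ℂ] H))ᗮ = K := by
      ext y
      rw [Submodule.mem_orthogonal, ← habs0]
      constructor
      · intro h
        refine ext_inner_left ℂ fun z => ?_
        rw [← hadj, inner_zero_right]
        exact h _ ⟨z, rfl⟩
      · rintro h _ ⟨z, rfl⟩
        show inner ℂ (CFC.abs V z) y = 0
        rw [hadj, h, inner_zero_right]
    rw [← h3, Submodule.orthogonal_orthogonal_eq_closure] at hx
    exact hx
  let e : H →L[ℂ] Kᗮ := (CFC.abs V).codRestrict Kᗮ hmem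
  have hd : DenseRange e := by
    intro z
    rw [Metric.mem_closure_iff]
    intro ε hε
    obtain ⟨_, ⟨b, rfl⟩, hb⟩ := Metric.mem_closure_iff.1 (hcl z z.2) ε hε
    exact ⟨e b, ⟨b, rfl⟩, hb⟩
  have hbd : ∀ x, ‖V x‖ ≤ 1 * ‖e x‖ := fun x => by
    rw [one_mul, ← cfcabs_norm]; exact le_rfl
  let Y' : Kᗮ →L[ℂ] H := LinearMap.extendOfNorm (V : H →ₗ[ℂ] H) (e : H →ₗ[ℂ] Kᗮ)
  have hY' : ∀ x, Y' (e x) = V x := fun x => LinearMap.extendOfNorm_eq hd ⟨1, hbd⟩ x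
  have hYn : ∀ z, ‖Y' z‖ = ‖z‖ := by
    intro z
    refine hd.induction_on z (isClosed_eq (by fun_prop) (by fun_prop)) fun x => ?_
    rw [hY', ← cfcabs_norm]; rfl
  have hproj : ∀ (x : H) (hx : x ∈ Kᗮ), Kᗮ.orthogonalProjectionOnto x = ⟨x, hx⟩ := fun x hx =>
    Submodule.orthogonalProjectionOnto_mem_subspace_eq_self (⟨x, hx⟩ : Kᗮ)
  refine ⟨Y'.comp Kᗮ.orthogonalProjectionOnto, fun x => ?_, fun x hx => ?_, fun x hx => ?_, hcl⟩
  · rw [comp_apply, hproj _ (hmem x)]; exact hY' x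
  · rw [comp_apply, Submodule.orthogonalProjectionOnto_eq_zero_iff.2 (K.le_orthogonal_orthogonal hx), map_zero]
  · rw [comp_apply, hproj _ hx, hYn]; rfl

theorem polar_inter (V Y B T : H →L[ℂ] H) (K : Submodule ℂ H) [CompleteSpace K]
    (hK : ∀ x, x ∈ K ↔ V x = 0) (h1 : ∀ x, Y (CFC.abs V x) = V x) (h2 : ∀ x ∈ K, Y x = 0)
    (h4 : ∀ x ∈ Kᗮ, x ∈ closure (Set.range (fun z => CFC.abs V z)))
    (hc : Commute (CFC.abs V) B) (hTV : ∀ x, T (V x) = V (B x)) (x : H) : Y (B x) = T (Y x) := by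
  have hcx : ∀ x, CFC.abs V (B x) = B (CFC.abs V x) := fun x => congrArg (fun A : H →L[ℂ] H => A x) hc.eq
  have a : ∀ z ∈ K, Y (B z) = T (Y z) := fun z hz => by
    rw [h2 z hz, map_zero]
    exact h2 _ ((hK _).2 (by rw [← hTV, (hK z).1 hz, map_zero]))
  have b : ∀ z ∈ Kᗮ, Y (B z) = T (Y z) := fun z hz => by
    have hcl : IsClosed {z | Y (B z) = T (Y z)} := isClosed_eq (by fun_prop) (by fun_prop)
    refine closure_minimal ?_ hcl (h4 z hz)
    rintro _ ⟨w, rfl⟩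
    show Y (B (CFC.abs V w)) = T (Y (CFC.abs V w))
    rw [← hcx, h1, h1, hTV]
  have hx := K.starProjection_add_starProjection_orthogonal x
  rw [← hx]
  simp only [map_add]
  rw [a _ (Submodule.starProjection_apply_mem _ _), b _ (Submodule.starProjection_apply_mem _ _)]
end


section
variable {H ι : Type*} [NormedAddCommGroup H] [InnerProductSpace ℂ H] [CompleteSpace H]

theorem weak_inter (l : Filter ι) [NeBot l] (Z : ι → H →ₗᵢ[ℂ] H) (V T B : H →L[ℂ] H)
    (hV : ∀ x y, Tendsto (fun i => inner ℂ y (Z i x)) l (𝓝 (inner ℂ y (V x))))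
    (h1 : ∀ x, Tendsto (fun i => T (Z i x) - Z i (B x)) l (𝓝 0)) (x : H) : T (V x) = V (B x) := by
  refine ext_inner_left ℂ fun y => ?_
  have a := hV x (adjoint T y)
  simp only [adjoint_inner_left] at a
  have b := hV (B x) y
  have c : Tendsto (fun i => inner ℂ y (T (Z i x) - Z i (B x))) l (𝓝 (inner ℂ y (0:H))) :=
    tendsto_const_nhds.inner (h1 x)
  simp only [inner_sub_right, inner_zero_right] at c
  have d := a.sub b
  exact sub_eq_zero.1 (tendsto_nhds_unique d c)

theorem proj_comm (B : H →L[ℂ] H) (K : Submodule ℂ H) [CompleteSpace K] (hB : ∀ x ∈ K, B x ∈ K)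
    (hB' : ∀ x ∈ K, adjoint B x ∈ K) (x : H) : K.starProjection (B x) = B (K.starProjection x) := by
  have hx := K.starProjection_add_starProjection_orthogonal x
  conv_lhs => rw [← hx]
  rw [map_add, map_add, Submodule.starProjection_eq_self_iff.2 (hB _ (Submodule.starProjection_apply_mem _ _))]
  have : B (Kᗮ.starProjection x) ∈ Kᗮ := by
    rw [Submodule.mem_orthogonal]
    intro u hu
    rw [← adjoint_inner_left]
    exact (Submodule.mem_orthogonal _ _).1 (Submodule.starProjection_apply_mem _ _) _ (hB' u hu)
  have hz : K.starProjection (B (Kᗮ.starProjection x)) = 0 := by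
    rw [Submodule.starProjection_apply, Submodule.orthogonalProjectionOnto_eq_zero_iff.2 this]; rfl
  rw [hz, add_zero]

theorem opRestrict_adjoint (B : H →L[ℂ] H) (K : Submodule ℂ H) [CompleteSpace K] (hB : ∀ x ∈ K, B x ∈ K)
    (hB' : ∀ x ∈ K, adjoint B x ∈ K) : adjoint (opRestrict B K hB) = opRestrict (adjoint B) K hB' := by
  symm
  rw [ContinuousLinearMap.eq_adjoint_iff]
  intro x y
  show inner ℂ (adjoint B x) (y : H) = inner ℂ (x : H) (B y)
  rw [adjoint_inner_left]

theorem hard_dir [TopologicalSpace.SeparableSpace H] (T B : H →L[ℂ] H)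
    (h : B ∈ starSotClosure (unitaryOrbit T)) :
    ∃ A ∈ closure (unitaryOrbit T), IsReducingPartOf B A := by
  obtain ⟨u, hu1, hu2⟩ := (@mem_closure_iff_ultrafilter _ _ _ (starSot H)).1 h
  have hW : ∀ A : H →L[ℂ] H, ∃ W : H ≃ₗᵢ[ℂ] H, A ∈ unitaryOrbit T → A = conjOp W T := fun A => by
    by_cases hA : A ∈ unitaryOrbit T
    · obtain ⟨W, hW⟩ := hA
      exact ⟨W, fun _ => hW⟩
    · exact ⟨LinearIsometryEquiv.refl ℂ H, fun h => absurd h hA⟩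
  choose W hW using hW
  let Z : (H →L[ℂ] H) → H →ₗᵢ[ℂ] H := fun A => (W A).symm.toLinearIsometry
  have hW1 : ∀ᶠ A in (u : Filter (H →L[ℂ] H)), A = conjOp (W A) T :=
    Filter.mem_of_superset hu1 fun A hA => hW A hA
  have ht := (starSot_tendsto (f := id) (l := (u : Filter (H →L[ℂ] H))) (B := B)).1 hu2
  have h1 : ∀ x, Tendsto (fun A => T (Z A x) - Z A (B x)) u (𝓝 0) := fun x => by
    have a := (ht.1 x).sub_const (B x)
    rw [sub_self] at a
    rw [tendsto_zero_iff_norm_tendsto_zero] at a ⊢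
    refine a.congr' ?_
    filter_upwards [hW1] with A hA
    have e : T (Z A x) = Z A (A x) := by
      show T ((W A).symm x) = (W A).symm (A x)
      have hx : A x = W A (T ((W A).symm x)) := congrArg (fun C : H →L[ℂ] H => C x) hA
      rw [hx, LinearIsometryEquiv.symm_apply_apply]
    rw [e, ← map_sub, LinearIsometry.norm_map]; rfl
  have h2 : ∀ x, Tendsto (fun A => adjoint T (Z A x) - Z A (adjoint B x)) u (𝓝 0) := fun x => by
    have a := (ht.2 x).sub_const (adjoint B x)
    rw [sub_self] at a
    rw [tendsto_zero_iff_norm_tendsto_zero] at a ⊢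
    refine a.congr' ?_
    filter_upwards [hW1] with A hA
    have e : adjoint T (Z A x) = Z A (adjoint A x) := by
      show adjoint T ((W A).symm x) = (W A).symm (adjoint A x)
      have hA' : adjoint A = conjOp (W A) (adjoint T) := by
        rw [← conjOp_adjoint, ← hA]
      rw [hA', conjOp_apply, LinearIsometryEquiv.symm_apply_apply]
    rw [e, ← map_sub, LinearIsometry.norm_map]; rfl
  obtain ⟨V, hV⟩ := weak_lim u Z
  have hTV := weak_inter u Z V T B hV h1
  have hTV' := weak_inter u Z V (adjoint T) (adjoint B) hV h2
  let K : Submodule ℂ H := LinearMap.ker (V : H →ₗ[ℂ] H)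
  have hK : ∀ x, x ∈ K ↔ V x = 0 := fun x => LinearMap.mem_ker
  have hKc : IsClosed (K : Set H) := V.isClosed_ker
  clear_value K
  haveI : CompleteSpace K := hKc.completeSpace_coe
  haveI : SecondCountableTopology H := UniformSpace.secondCountable_of_separable H
  haveI : TopologicalSpace.SeparableSpace K := inferInstance
  have hB : ∀ x ∈ K, B x ∈ K := fun x hx => (hK _).2 (by rw [← hTV, (hK x).1 hx, map_zero])
  have hB' : ∀ x ∈ K, adjoint B x ∈ K := fun x hx => (hK _).2 (by rw [← hTV', (hK x).1 hx, map_zero])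
  have hadj := opRestrict_adjoint B K hB hB'
  let Z' : (H →L[ℂ] H) → K →ₗᵢ[ℂ] H := fun A => (Z A).comp K.subtypeₗᵢ
  have key := key_absorb T (opRestrict B K hB) (u : Filter (H →L[ℂ] H)) Z'
    (fun x y => by
      have := hV x y
      rw [(hK x).1 x.2, inner_zero_right] at this
      exact this)
    (fun x => h1 x)
    (fun x => by rw [hadj]; exact h2 x)
  obtain ⟨U0, hU0⟩ := key 1 one_pos
  have hcomm : ∀ x, star V (V (B x)) = B (star V (V x)) := fun x => by
    refine ext_inner_left ℂ fun y => ?_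
    rw [star_eq_adjoint, adjoint_inner_right, ← hTV, ← adjoint_inner_left, hTV', ← adjoint_inner_left B,
      adjoint_inner_right]
  have hcomm' : ∀ x, star V (V (adjoint B x)) = adjoint B (star V (V x)) := fun x => by
    refine ext_inner_left ℂ fun y => ?_
    rw [star_eq_adjoint, adjoint_inner_right, ← hTV', adjoint_inner_right, hTV, adjoint_inner_right,
      adjoint_inner_right]
  have hc1 : Commute (CFC.abs V) B := abs_comm V B (ContinuousLinearMap.ext hcomm)
  have hc2 : Commute (CFC.abs V) (adjoint B) := abs_comm V (adjoint B) (ContinuousLinearMap.ext hcomm')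
  obtain ⟨Y, y1, y2, y3, y4⟩ := polar_ex V K hK
  have hYB := polar_inter V Y B T K hK y1 y2 y4 hc1 hTV
  have hYB' := polar_inter V Y (adjoint B) (adjoint T) K hK y1 y2 y4 hc2 hTV'
  refine ⟨conjOp U0 (dsum T (opRestrict B K hB)), ?_, ?_⟩
  · rw [Metric.mem_closure_iff]
    intro ε hε
    obtain ⟨U, hU⟩ := key (ε/2) (by positivity)
    refine ⟨conjOp (U.symm.trans U0) T, ⟨_, rfl⟩, ?_⟩
    rw [dist_eq_norm]
    refine lt_of_le_of_lt (ContinuousLinearMap.opNorm_le_bound _ (by positivity : (0:ℝ) ≤ ε/2) fun x => ?_) (half_lt_self hε)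
    show ‖U0 (dsum T (opRestrict B K hB) (U0.symm x)) - U0 (U.symm (T (U (U0.symm x))))‖ ≤ ε/2 * ‖x‖
    rw [← map_sub, LinearIsometryEquiv.norm_map, ← LinearIsometryEquiv.norm_map U, map_sub,
      LinearIsometryEquiv.apply_symm_apply]
    have h := ContinuousLinearMap.le_of_opNorm_le _ hU (U (U0.symm x))
    rw [LinearIsometryEquiv.norm_map, LinearIsometryEquiv.norm_map, ContinuousLinearMap.sub_apply, conjOp_apply,
      LinearIsometryEquiv.symm_apply_apply] at h
    exact h
  · let X0 : H →ₗ[ℂ] WithLp 2 (H × K) :=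
      { toFun := fun x => WithLp.toLp 2 (Y x, K.orthogonalProjectionOnto x)
        map_add' := fun x y => by rw [map_add, map_add]; rfl
        map_smul' := fun a x => by rw [map_smul, map_smul]; rfl }
    have hX0n : ∀ x, ‖X0 x‖ = ‖x‖ := fun x => by
      have e1 : ‖X0 x‖^2 = ‖Y x‖^2 + ‖K.orthogonalProjectionOnto x‖^2 := WithLp.prod_norm_sq_eq_of_L2 (X0 x)
      have e2 : Y x = Y (Kᗮ.starProjection x) := by
        conv_lhs => rw [← K.starProjection_add_starProjection_orthogonal x]
        rw [map_add, y2 _ (Submodule.starProjection_apply_mem _ _), zero_add]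
      have e3 : ‖Y x‖ = ‖Kᗮ.starProjection x‖ := by
        rw [e2, y3 _ (Submodule.starProjection_apply_mem _ _)]
      have e4 : ‖x‖^2 = ‖K.starProjection x‖^2 + ‖Kᗮ.starProjection x‖^2 := by
        conv_lhs => rw [← K.starProjection_add_starProjection_orthogonal x]
        have ho : inner ℂ (K.starProjection x) (Kᗮ.starProjection x) = 0 :=
          (Submodule.mem_orthogonal _ _).1 (Submodule.starProjection_apply_mem _ _) _
            (Submodule.starProjection_apply_mem _ _)
        have := norm_add_sq (𝕜 := ℂ) (K.starProjection x) (Kᗮ.starProjection x)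
        rw [ho] at this
        simpa using this
      have e5 : ‖K.orthogonalProjectionOnto x‖ = ‖K.starProjection x‖ := rfl
      exact (pow_left_inj₀ (norm_nonneg _) (norm_nonneg _) (by norm_num : (2:ℕ) ≠ 0)).1
        (by rw [e1, e4, e3, e5]; ring)
    let X : H →ₗᵢ[ℂ] H := U0.toLinearIsometry.comp ⟨X0, hX0n⟩
    have hX : ∀ x, X x = U0 (WithLp.toLp 2 (Y x, K.orthogonalProjectionOnto x)) := fun x => rfl
    have hgen : ∀ (B' T' : H →L[ℂ] H) (hk : ∀ x ∈ K, B' x ∈ K), (∀ x ∈ K, adjoint B' x ∈ K) →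
        (∀ x, Y (B' x) = T' (Y x)) →
        ∀ x, X (B' x) = conjOp U0 (dsum T' (opRestrict B' K hk)) (X x) := by
      intro B' T' hk hk' hY x
      rw [conjOp_apply, hX, hX, LinearIsometryEquiv.symm_apply_apply]
      congr 1
      have e : K.orthogonalProjectionOnto (B' x) = opRestrict B' K hk (K.orthogonalProjectionOnto x) :=
        Subtype.ext (proj_comm B' K hk hk' x)
      rw [hY, e]; rfl
    refine reducing_of_isometry B _ X (hgen B T hB hB' hYB) ?_
    rw [conjOp_adjoint, dsum_adjoint, hadj]
    exact hgen (adjoint B) (adjoint T) hB' (by simpa using hB) hYB'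
end


/-- **Theorem 3.7, *-SOT case.** The *-SOT closure of the unitary orbit of `T` is
the set of operators unitarily equivalent to reducing parts of operators in the norm closure of
the unitary orbit of `T`. -/
theorem stmt17 {H : Type*} [NormedAddCommGroup H] [InnerProductSpace ℂ H] [CompleteSpace H]
    [TopologicalSpace.SeparableSpace H] (hinf : ¬ FiniteDimensional ℂ H)
    (T : H →L[ℂ] H) :
    starSotClosure (unitaryOrbit T) =
      {B : H →L[ℂ] H | ∃ A ∈ closure (unitaryOrbit T), IsReducingPartOf B A} := by
  ext B
  exact ⟨fun h => hard_dir T B h, fun ⟨A, hA, h⟩ => easy_dir hinf T A B hA h⟩
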